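/- arXiv:2503.03461 — 3 statements merged into one kernel-verified Lean document; each statement's English description precedes it below -/
import Mathlib

section
/- Let Γ be a non-elementary Fuchsian group, i.e., a discrete subgroup of PSL₂(ℝ) which does not contain a cyclic subgroup of finite index. Then there exist two hyperbolic elements γ₁, γ₂ ∈ Γ whose translation lengths ℓ(γ₁) and ℓ(γ₂) are linearly independent over ℚ. -/
/-- `SL(2, ℝ)`. -/
abbrev SL2R := Matrix.SpecialLinearGroup (Fin 2) ℝ

/-- The subspace topology on `SL(2, ℝ)` induced from the space of matrices. -/
noncomputable instance : TopologicalSpace SL2R :=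
  TopologicalSpace.induced (fun g => (g : Matrix (Fin 2) (Fin 2) ℝ)) inferInstance

/-- `PSL(2, ℝ)`, the quotient of `SL(2, ℝ)` by its center `{±1}`. -/
abbrev PSL2R := SL2R ⧸ Subgroup.center SL2R

/-- The translation length of a hyperbolic element represented by `g ∈ SL(2, ℝ)`
with `|tr g| > 2`: `2 log((|tr g| + √(tr(g)² − 4))/2)`. -/
noncomputable def translationLength (g : SL2R) : ℝ :=
  2 * Real.log ((|Matrix.trace (g : Matrix (Fin 2) (Fin 2) ℝ)| +
    Real.sqrt (Matrix.trace (g : Matrix (Fin 2) (Fin 2) ℝ) ^ 2 - 4)) / 2)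

open scoped Pointwise

/-- Let `K` be a subfield of `ℝ`. If `x + x⁻¹` and some positive power of `x > 1` lie in `K`,
then so does `x`. -/
theorem mem_of_add_inv_mem_of_pow_mem (K : IntermediateField ℚ ℝ) {x : ℝ} (hx : 1 < x)
    (htr : x + x⁻¹ ∈ K) {n : ℕ} (hn : n ≠ 0) (hpow : x ^ n ∈ K) : x ∈ K := by
  have hx0 : x ≠ 0 := by positivity
  have hinv : x⁻¹ < 1 := inv_lt_one_of_one_lt₀ hx
  have hd : x - x⁻¹ ≠ 0 := by linarith
  have hS : ∀ m : ℕ, (x ^ m - (x ^ m)⁻¹) / (x - x⁻¹) ∈ K ∧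
      (x ^ (m + 1) - (x ^ (m + 1))⁻¹) / (x - x⁻¹) ∈ K := by
    intro m
    induction m with
    | zero => simp [hd]
    | succ k ih =>
      refine ⟨ih.2, ?_⟩
      have h := K.sub_mem (K.mul_mem htr ih.2) ih.1
      convert h using 1
      have hx2 : x ^ 2 - 1 ≠ 0 := by nlinarith
      field_simp
      ring
  have hxn : 1 < x ^ n := one_lt_pow₀ hx hn
  have hxn' : (x ^ n)⁻¹ < 1 := inv_lt_one_of_one_lt₀ hxn
  have hnum : x ^ n - (x ^ n)⁻¹ ≠ 0 := by linarith
  have hdiff : x - x⁻¹ ∈ K := by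
    have h := K.div_mem (K.sub_mem hpow (K.inv_mem hpow)) (hS n).1
    rwa [div_div_cancel₀ hnum] at h
  have h2 : (2 : ℝ) ∈ K := ofNat_mem K 2
  have h := K.div_mem (K.add_mem htr hdiff) h2
  convert h using 1
  ring

/-- An element of a number field has only finitely many roots of all positive orders. -/
theorem finite_setOf_exists_pow_eq (K : Type*) [Field K] [NumberField K] (y : K) :
    {x : K | ∃ n : ℕ, n ≠ 0 ∧ x ^ n = y}.Finite := by
  obtain ⟨D, hD0, hD⟩ := IsAlgebraic.exists_integral_multiple
    ((IsFractionRing.isAlgebraic_iff ℤ ℚ K).2 (IsAlgebraic.of_finite ℚ y))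
  have hDK : (D : K) ≠ 0 := by exact_mod_cast hD0
  set B : ℝ := 1 + ∑ φ : K →+* ℂ, ‖φ y‖ with hB
  have hB1 : 1 ≤ B := by
    have : 0 ≤ ∑ φ : K →+* ℂ, ‖φ y‖ := Finset.sum_nonneg fun _ _ => norm_nonneg _
    linarith
  have hfin := NumberField.Embeddings.finite_of_norm_le K ℂ (‖(D : ℂ)‖ * B)
  refine Set.Finite.subset (hfin.preimage (f := fun x : K => (D : K) * x)
    (mul_right_injective₀ hDK).injOn) ?_
  rintro x ⟨n, hn, hxy⟩
  refine ⟨?_, fun φ => ?_⟩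
  · refine IsIntegral.of_pow (Nat.pos_of_ne_zero hn) ?_
    obtain ⟨m, rfl⟩ := Nat.exists_eq_succ_of_ne_zero hn
    have : ((D : K) * x) ^ (m + 1) = (D : K) ^ m * (D • y) := by
      rw [mul_pow, hxy, zsmul_eq_mul]; ring
    rw [Nat.succ_eq_add_one, this]
    exact ((isIntegral_algebraMap (R := ℤ) (x := D)).pow m).mul hD
  · rw [map_mul, map_intCast, norm_mul]
    refine mul_le_mul_of_nonneg_left ?_ (norm_nonneg _)
    by_contra! h
    have h1 : ‖φ x‖ ^ n = ‖φ y‖ := by rw [← norm_pow, ← map_pow, hxy]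
    have h2 : ‖φ x‖ ≤ ‖φ x‖ ^ n := le_self_pow₀ (hB1.trans h.le) hn
    have h3 : ‖φ y‖ ≤ ∑ ψ : K →+* ℂ, ‖ψ y‖ :=
      Finset.single_le_sum (f := fun ψ : K →+* ℂ => ‖ψ y‖) (fun _ _ => norm_nonneg _)
        (Finset.mem_univ φ)
    linarith

/-- If `L > 1` lies in a number field `K`, only finitely many denominators occur
among the rational powers `L ^ r` with `L ^ r + L ^ (-r) ∈ K`. -/
theorem finite_setOf_den_of_rpow_add_mem (K : IntermediateField ℚ ℝ) [FiniteDimensional ℚ K]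
    {L : ℝ} (hL : 1 < L) (hLK : L ∈ K) :
    {d : ℕ | ∃ r : ℚ, 0 < r ∧ r.den = d ∧ L ^ (r : ℝ) + (L ^ (r : ℝ))⁻¹ ∈ K}.Finite := by
  have : NumberField K := ⟨⟩
  have hL0 : 0 < L := by positivity
  have hfin := (finite_setOf_exists_pow_eq K ⟨L, hLK⟩).image (fun x : K => (x : ℝ))
  refine Set.Finite.of_finite_image (f := fun d : ℕ => L ^ ((d : ℝ)⁻¹)) (hfin.subset ?_) ?_
  · rintro _ ⟨_, ⟨r, hr, rfl, hK⟩, rfl⟩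
    have hden : (r.den : ℝ) ≠ 0 := by exact_mod_cast r.den_ne_zero
    have hpow : (L ^ (r : ℝ)) ^ r.den = L ^ r.num := by
      rw [← Real.rpow_natCast, ← Real.rpow_mul hL0.le, ← Real.rpow_intCast]
      congr 1
      exact_mod_cast r.mul_den_eq_num
    have hmem : L ^ (r : ℝ) ∈ K := by
      refine mem_of_add_inv_mem_of_pow_mem K (Real.one_lt_rpow hL (by exact_mod_cast hr)) hK
        r.den_ne_zero ?_
      rw [hpow]
      exact zpow_mem hLK _
    obtain ⟨u, v, huv⟩ : IsCoprime r.num (r.den : ℤ) := by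
      rw [Int.isCoprime_iff_gcd_eq_one]
      exact r.reduced
    have hroot : L ^ ((r.den : ℝ)⁻¹) ∈ K := by
      have h := K.mul_mem (zpow_mem hmem u) (zpow_mem hLK v)
      convert h using 1
      rw [← Real.rpow_intCast, ← Real.rpow_intCast, ← Real.rpow_mul hL0.le,
        ← Real.rpow_add hL0]
      congr 1
      have h1 : (u : ℝ) * r.num + v * r.den = 1 := by exact_mod_cast huv
      have h2 : (r : ℝ) = r.num / r.den := by exact_mod_cast (Rat.num_div_den r).symm
      rw [h2]
      field_simp
      linarith
    refine ⟨⟨_, hroot⟩, ⟨r.den, r.den_ne_zero, ?_⟩, rfl⟩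
    ext
    simp only [SubmonoidClass.coe_pow]
    exact Real.rpow_inv_natCast_pow hL0.le r.den_ne_zero
  · rintro _ _ _ _ h
    have h1 := (Real.rpow_right_inj hL0 hL.ne').1 h
    exact_mod_cast inv_injective h1

open Polynomial in
/-- Comparison of leading exponents, for transcendental `z`. -/
theorem add_eq_add_of_transcendental {z : ℝ} (hz : Transcendental ℚ z) {A B M N : ℕ}
    (hA : A ≠ 0) (hB : B ≠ 0) (hM : M ≠ 0) (hN : N ≠ 0) (s : ℚ)
    (h : z ^ (B + N) * (z ^ A - s) ^ 2 * (z ^ M - 1) ^ 2 =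
      z ^ (A + M) * (z ^ B - s) ^ 2 * (z ^ N - 1) ^ 2) : A + M = B + N := by
  have hpoly : (X ^ (B + N) * (X ^ A - C s) ^ 2 * (X ^ M - C 1) ^ 2 : ℚ[X]) =
      X ^ (A + M) * (X ^ B - C s) ^ 2 * (X ^ N - C 1) ^ 2 := by
    apply transcendental_iff_injective.1 hz
    simpa using h
  have hdeg : ∀ a b c : ℕ, b ≠ 0 → c ≠ 0 →
      (X ^ a * (X ^ b - C s) ^ 2 * (X ^ c - C 1) ^ 2 : ℚ[X]).natDegree = a + 2 * b + 2 * c := by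
    intro a b c hb hc
    have h1 : (X ^ b - C s : ℚ[X]).Monic := monic_X_pow_sub_C s hb
    have h2 : (X ^ c - C 1 : ℚ[X]).Monic := monic_X_pow_sub_C 1 hc
    rw [((monic_X_pow a).mul (h1.pow 2)).natDegree_mul (h2.pow 2),
      (monic_X_pow a).natDegree_mul (h1.pow 2), h1.natDegree_pow, h2.natDegree_pow,
      natDegree_X_pow, natDegree_X_pow_sub_C, natDegree_X_pow_sub_C]
  have h1 := congrArg natDegree hpoly
  rw [hdeg _ _ _ hA hM, hdeg _ _ _ hB hN] at h1
  omega

/-- If `L ^ r n + L ^ (-r n) = c * (L ^ n + L ^ (-n) - 2) ± 2` for rational exponents `r n`,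
then these exponents have a common denominator. -/
theorem exists_common_denominator {L : ℝ} (hL : 1 < L) {c s : ℝ} (hs : s = 1 ∨ s = -1) {m : ℕ}
    (hm : m ≠ 0) {r : ℕ → ℚ} (hr : ∀ n, m ≤ n → 0 < r n)
    (h : ∀ n, m ≤ n → L ^ (r n : ℝ) + (L ^ (r n : ℝ))⁻¹ =
      c * (L ^ n + (L ^ n)⁻¹ - 2) + 2 * s) :
    ∃ Q : ℕ, Q ≠ 0 ∧ ∀ n, m ≤ n → ∃ k : ℤ, (Q : ℚ) * r n = k := by
  have hL0 : 0 < L := by positivity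
  obtain ⟨σ, rfl⟩ : ∃ σ : ℚ, s = σ := by
    rcases hs with rfl | rfl
    exacts [⟨1, by simp⟩, ⟨-1, by simp⟩]
  have hσ : (σ : ℝ) ^ 2 = 1 := by rcases hs with h | h <;> rw [h] <;> norm_num
  have hT : ∀ n : ℕ, n ≠ 0 → L ^ n + (L ^ n)⁻¹ - 2 ≠ 0 := by
    intro n hn
    have h1 : 1 < L ^ n := one_lt_pow₀ hL hn
    have h2 : L ^ n + (L ^ n)⁻¹ - 2 = (L ^ n - 1) ^ 2 / L ^ n := by field_simp; ring
    have h3 : L ^ n - 1 ≠ 0 := by linarith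
    rw [h2]
    positivity
  by_cases halg : IsAlgebraic ℚ L
  · set x := L ^ (r m : ℝ) with hx
    have hxalg : IsAlgebraic ℚ x := by
      refine IsAlgebraic.of_pow (n := (r m).den) (r m).pos ?_
      have : x ^ (r m).den = L ^ (r m).num := by
        rw [hx, ← Real.rpow_natCast, ← Real.rpow_mul hL0.le, ← Real.rpow_intCast]
        congr 1
        exact_mod_cast (r m).mul_den_eq_num
      rw [this]
      rw [← mem_algebraicClosure_iff] at halg ⊢
      exact zpow_mem halg _
    let K := IntermediateField.adjoin ℚ ({L, x} : Set ℝ)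
    have hLK : L ∈ K := IntermediateField.subset_adjoin _ _ (by simp)
    have hxK : x ∈ K := IntermediateField.subset_adjoin _ _ (by simp)
    have : FiniteDimensional ℚ K := by
      refine IntermediateField.finiteDimensional_adjoin ?_
      rintro y (rfl | rfl)
      exacts [halg.isIntegral, hxalg.isIntegral]
    have hσK : 2 * (σ : ℝ) ∈ K := K.mul_mem (ofNat_mem K 2) (SubfieldClass.ratCast_mem K σ)
    have hTK : ∀ n : ℕ, L ^ n + (L ^ n)⁻¹ - 2 ∈ K := fun n =>
      K.sub_mem (K.add_mem (pow_mem hLK n) (K.inv_mem (pow_mem hLK n))) (ofNat_mem K 2)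
    have hcK : c ∈ K := by
      have h1 := K.div_mem (K.sub_mem (K.add_mem hxK (K.inv_mem hxK)) hσK) (hTK m)
      rwa [h m le_rfl, add_sub_cancel_right, mul_div_cancel_right₀ _ (hT m hm)] at h1
    have hfin := finite_setOf_den_of_rpow_add_mem K hL hLK
    refine ⟨∏ d ∈ hfin.toFinset, d, ?_, fun n hn => ?_⟩
    · rw [Finset.prod_ne_zero_iff]
      intro d hd
      obtain ⟨ρ, -, rfl, -⟩ := hfin.mem_toFinset.1 hd
      exact ρ.den_ne_zero
    · have hmem : (r n).den ∈ hfin.toFinset := by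
        refine hfin.mem_toFinset.2 ⟨r n, hr n hn, rfl, ?_⟩
        rw [h n hn]
        exact K.add_mem (K.mul_mem hcK (hTK n)) hσK
      obtain ⟨e, he⟩ := Finset.dvd_prod_of_mem (fun d : ℕ => d) hmem
      refine ⟨e * (r n).num, ?_⟩
      rw [he]
      push_cast
      rw [← Rat.mul_den_eq_num (r n)]
      ring
  · refine ⟨(r m).den, (r m).den_ne_zero, fun n hn => ?_⟩
    have hn0 : n ≠ 0 := by omega
    obtain ⟨q, A, B, hq, hrn, hrm⟩ : ∃ q A B : ℕ, q ≠ 0 ∧ (r n : ℝ) = A / q ∧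
        (r m : ℝ) = B / q := by
      refine ⟨(r n).den * (r m).den, (r n).num.toNat * (r m).den, (r m).num.toNat * (r n).den,
        by simp, ?_, ?_⟩
      · have h1 : (((r n).num.toNat : ℤ) : ℝ) = ((r n).num : ℝ) := by
          rw [Int.toNat_of_nonneg (Rat.num_pos.2 (hr n hn)).le]
        have h2 : ((r n : ℚ) : ℝ) = (r n).num / (r n).den := by
          exact_mod_cast (Rat.num_div_den (r n)).symm
        have h3 : ((r m).den : ℝ) ≠ 0 := by exact_mod_cast (r m).den_ne_zero
        push_cast at h1 ⊢
        rw [h2, h1, mul_div_mul_right _ _ h3]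
      · have h1 : (((r m).num.toNat : ℤ) : ℝ) = ((r m).num : ℝ) := by
          rw [Int.toNat_of_nonneg (Rat.num_pos.2 (hr m le_rfl)).le]
        have h2 : ((r m : ℚ) : ℝ) = (r m).num / (r m).den := by
          exact_mod_cast (Rat.num_div_den (r m)).symm
        have h3 : ((r n).den : ℝ) ≠ 0 := by exact_mod_cast (r n).den_ne_zero
        push_cast at h1 ⊢
        rw [h2, h1, mul_comm ((r n).den : ℝ), mul_div_mul_right _ _ h3]
    have hq' : (q : ℝ) ≠ 0 := by exact_mod_cast hq
    have hrn0 : (0 : ℝ) < r n := by exact_mod_cast hr n hn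
    have hrm0 : (0 : ℝ) < r m := by exact_mod_cast hr m le_rfl
    have hA : A ≠ 0 := by rintro rfl; simp [hrn] at hrn0
    have hB : B ≠ 0 := by rintro rfl; simp [hrm] at hrm0
    set z := L ^ ((q : ℝ)⁻¹) with hzdef
    have hz0 : z ≠ 0 := (Real.rpow_pos_of_pos hL0 _).ne'
    have hzq : z ^ q = L := Real.rpow_inv_natCast_pow hL0.le hq
    have hzrat : ∀ a : ℕ, L ^ ((a : ℝ) / q) = z ^ a := by
      intro a
      rw [hzdef, ← Real.rpow_natCast, ← Real.rpow_mul hL0.le, div_eq_inv_mul]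
    have hz : Transcendental ℚ z := by
      intro hza
      exact halg (hzq ▸ hza.pow q)
    have e1 := h n hn
    have e2 := h m le_rfl
    have t1 := hT m hm
    have t2 := hT n hn0
    rw [hrn, hzrat] at e1
    rw [hrm, hzrat] at e2
    have key : (z ^ A + (z ^ A)⁻¹ - 2 * σ) * (L ^ m + (L ^ m)⁻¹ - 2) =
        (z ^ B + (z ^ B)⁻¹ - 2 * σ) * (L ^ n + (L ^ n)⁻¹ - 2) := by
      rw [e1, e2]; ring
    rw [← hzq, ← pow_mul, ← pow_mul] at key
    have hsq : ∀ a : ℕ, z ^ a + (z ^ a)⁻¹ - 2 * σ = (z ^ a - σ) ^ 2 / z ^ a := by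
      intro a
      have := pow_ne_zero a hz0
      field_simp
      linear_combination -hσ
    have hsq' : ∀ a : ℕ, z ^ a + (z ^ a)⁻¹ - 2 = (z ^ a - 1) ^ 2 / z ^ a := by
      intro a
      have := pow_ne_zero a hz0
      field_simp
      ring
    rw [hsq, hsq, hsq', hsq'] at key
    have hexp := add_eq_add_of_transcendental hz hA hB (mul_ne_zero hq hm) (mul_ne_zero hq hn0) σ
      (by
        have a1 := pow_ne_zero A hz0
        have a2 := pow_ne_zero B hz0
        have a3 := pow_ne_zero (q * m) hz0
        have a4 := pow_ne_zero (q * n) hz0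
        rw [div_mul_div_comm, div_mul_div_comm, div_eq_div_iff (mul_ne_zero a1 a3)
          (mul_ne_zero a2 a4)] at key
        rw [pow_add, pow_add]
        linear_combination key)
    have hrnm : r n = r m + n - m := by
      have h1 : (A : ℝ) + q * m = B + q * n := by exact_mod_cast hexp
      have h2 : (r n : ℝ) = r m + n - m := by
        rw [hrn, hrm]
        field_simp
        linarith
      exact_mod_cast h2
    refine ⟨(r m).num + (r m).den * (n - m), ?_⟩
    rw [hrnm]
    push_cast
    rw [← Rat.mul_den_eq_num (r m)]
    ring

open Filter Topology in
/-- For `c ≠ 0, 1`, the numbers `|c * (L ^ n + L ^ (-n) - 2) + 2|` greater than `2` cannot all be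
of the form `L ^ r + L ^ (-r)` with `r` rational. -/
theorem not_forall_exists_rat_rpow {L : ℝ} (hL : 1 < L) {c : ℝ} (hc0 : c ≠ 0) (hc1 : c ≠ 1)
    (h : ∀ n : ℕ, 2 < |c * (L ^ n + (L ^ n)⁻¹ - 2) + 2| → ∃ r : ℚ, 0 < r ∧
      L ^ (r : ℝ) + (L ^ (r : ℝ))⁻¹ = |c * (L ^ n + (L ^ n)⁻¹ - 2) + 2|) : False := by
  have hL0 : 0 < L := by positivity
  obtain ⟨s, hs, hcs⟩ : ∃ s : ℝ, (s = 1 ∨ s = -1) ∧ 0 < s * c := by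
    rcases hc0.lt_or_gt with hc | hc
    exacts [⟨-1, Or.inr rfl, by linarith⟩, ⟨1, Or.inl rfl, by linarith⟩]
  set d := s * c with hd
  have hds : d ≠ s := by
    rcases hs with rfl | rfl
    · simpa [hd] using hc1
    · simp only [hd]; contrapose! hc1; linarith
  have hpow : Tendsto (fun n : ℕ => L ^ n) atTop atTop := tendsto_pow_atTop_atTop_of_one_lt hL
  have hinv : Tendsto (fun n : ℕ => (L ^ n)⁻¹) atTop (𝓝 0) := hpow.inv_tendsto_atTop
  have hinv0 : ∀ n : ℕ, 0 < (L ^ n)⁻¹ := fun n => by positivity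
  have hev : ∀ᶠ n : ℕ in atTop, 2 < d * (L ^ n + (L ^ n)⁻¹ - 2) + 2 * s := by
    filter_upwards [hpow.eventually_gt_atTop (2 + 4 / d)] with n hn
    have h1 : 4 / d < L ^ n + (L ^ n)⁻¹ - 2 := by linarith [hinv0 n]
    rw [div_lt_iff₀ hcs] at h1
    rcases hs with hs | hs <;> rw [hs] <;> nlinarith
  obtain ⟨m, hm⟩ := eventually_atTop.1 (hev.and (eventually_ge_atTop 1))
  have hm0 : m ≠ 0 := by have := (hm m le_rfl).2; omega
  have hex : ∀ n, m ≤ n → ∃ r : ℚ, 0 < r ∧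
      L ^ (r : ℝ) + (L ^ (r : ℝ))⁻¹ = d * (L ^ n + (L ^ n)⁻¹ - 2) + 2 * s := by
    intro n hn
    have h1 := (hm n hn).1
    have h2 : |c * (L ^ n + (L ^ n)⁻¹ - 2) + 2| = d * (L ^ n + (L ^ n)⁻¹ - 2) + 2 * s := by
      rw [← abs_of_pos (zero_lt_two.trans h1)]
      have h3 : d * (L ^ n + (L ^ n)⁻¹ - 2) + 2 * s =
        s * (c * (L ^ n + (L ^ n)⁻¹ - 2) + 2) := by rw [hd]; ring
      rw [h3, abs_mul]
      rcases hs with hs | hs <;> simp [hs]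
    rw [← h2]
    exact h n (by rw [h2]; exact h1)
  choose! r hr hreq using hex
  obtain ⟨Q, hQ, hk⟩ := exists_common_denominator hL hs hm0 hr hreq
  choose! k hk using hk
  have hQ' : (0 : ℝ) < Q := by exact_mod_cast Nat.pos_of_ne_zero hQ
  -- the exponents are asymptotic to `n + log d / log L`
  set y : ℕ → ℝ := fun n => L ^ ((r n : ℝ) - n) with hy
  have hyr : ∀ n, L ^ (r n : ℝ) = y n * L ^ n := by
    intro n
    rw [hy, ← Real.rpow_natCast, ← Real.rpow_add hL0, sub_add_cancel]
  have hy0 : ∀ n, 0 < y n := fun n => Real.rpow_pos_of_pos hL0 _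
  have hlim : Tendsto y atTop (𝓝 d) := by
    have h1 : Tendsto (fun n : ℕ => d * (1 + (L ^ n)⁻¹ * (L ^ n)⁻¹) +
        (2 * s - 2 * d) * (L ^ n)⁻¹) atTop (𝓝 (d * (1 + 0 * 0) + (2 * s - 2 * d) * 0)) :=
      ((tendsto_const_nhds.add (hinv.mul hinv)).const_mul d).add (hinv.const_mul _)
    have h2 : Tendsto (fun n : ℕ => d * (1 + (L ^ n)⁻¹ * (L ^ n)⁻¹) +
        (2 * s - 2 * d) * (L ^ n)⁻¹ - (L ^ n)⁻¹) atTop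
        (𝓝 (d * (1 + 0 * 0) + (2 * s - 2 * d) * 0 - 0)) := h1.sub hinv
    simp only [mul_zero, add_zero, mul_one, sub_zero] at h1 h2
    have hid : ∀ n, m ≤ n → y n = d * (1 + (L ^ n)⁻¹ * (L ^ n)⁻¹) +
        (2 * s - 2 * d) * (L ^ n)⁻¹ - (L ^ (r n : ℝ))⁻¹ * (L ^ n)⁻¹ := by
      intro n hn
      have h3 := hreq n hn
      have hLn : L ^ n * (L ^ n)⁻¹ = 1 := mul_inv_cancel₀ (by positivity)
      rw [hyr] at h3 ⊢
      linear_combination (L ^ n)⁻¹ * h3 + (d - y n) * hLn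
    refine tendsto_of_tendsto_of_tendsto_of_le_of_le' h2 h1 ?_ ?_
    · filter_upwards [eventually_ge_atTop m] with n hn
      rw [hid n hn]
      have h4 : (L ^ (r n : ℝ))⁻¹ < 1 :=
        inv_lt_one_of_one_lt₀ (Real.one_lt_rpow hL (by exact_mod_cast hr n hn))
      have := mul_le_mul_of_nonneg_right h4.le (hinv0 n).le
      linarith
    · filter_upwards [eventually_ge_atTop m] with n hn
      rw [hid n hn]
      have h4 : 0 < (L ^ (r n : ℝ))⁻¹ := by positivity
      have := mul_pos h4 (hinv0 n)
      linarith
  have hlogL : 0 < Real.log L := Real.log_pos hL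
  have hint : Tendsto (fun n => (Q : ℝ) * ((r n : ℝ) - n)) atTop
      (𝓝 (Q * (Real.log d / Real.log L))) := by
    refine Tendsto.const_mul _ ?_
    have h1 := ((Real.continuousAt_log hcs.ne').tendsto.comp hlim).div_const (Real.log L)
    refine h1.congr fun n => ?_
    simp only [Function.comp, hy]
    rw [Real.log_rpow hL0, mul_div_cancel_right₀ _ hlogL.ne']
  -- hence, having bounded denominators, they differ from `n` by a constant
  obtain ⟨N, hN⟩ := eventually_atTop.1 ((Metric.tendsto_nhds.1 hint (1 / 2) (by norm_num)).and
    (eventually_ge_atTop m))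
  have hcast : ∀ n, m ≤ n → (Q : ℝ) * r n = k n := fun n hn => by exact_mod_cast hk n hn
  have hconst : ∀ n, N ≤ n → y n = y N := by
    intro n hn
    have h1 := (hN n hn).1
    have h2 := (hN N le_rfl).1
    have h3 := dist_triangle_right ((Q : ℝ) * ((r n : ℝ) - n)) (Q * ((r N : ℝ) - N))
      (Q * (Real.log d / Real.log L))
    have h4 : dist ((Q : ℝ) * ((r n : ℝ) - n)) (Q * ((r N : ℝ) - N)) < 1 := by linarith
    rw [mul_sub, mul_sub, hcast n (hN n hn).2, hcast N (hN N le_rfl).2, Real.dist_eq] at h4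
    have h5 : |(k n - Q * n) - (k N - Q * N)| < 1 := by exact_mod_cast h4
    have h6 : k n - Q * n = k N - Q * N := by
      have := Int.abs_lt_one_iff.1 h5
      linarith
    have h7 : (k n : ℝ) - Q * n = k N - Q * N := by exact_mod_cast h6
    rw [← hcast n (hN n hn).2, ← hcast N (hN N le_rfl).2, ← mul_sub, ← mul_sub] at h7
    simp only [hy]
    rw [mul_left_cancel₀ hQ'.ne' h7]
  have hyd : y N = d :=
    tendsto_nhds_unique (tendsto_const_nhds.congr' (by
      filter_upwards [eventually_ge_atTop N] with n hn using (hconst n hn).symm)) hlim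
  have hzero : Tendsto (fun n : ℕ => (d⁻¹ - d) * (L ^ n)⁻¹) atTop (𝓝 (2 * s - 2 * d)) := by
    refine tendsto_const_nhds.congr' ?_
    filter_upwards [eventually_ge_atTop N] with n hn
    have h1 := hreq n (hN n hn).2
    rw [hyr, hconst n hn, hyd, mul_inv] at h1
    linarith
  have h0 := tendsto_nhds_unique hzero (by simpa using hinv.const_mul (d⁻¹ - d))
  exact hds (by linarith)

namespace SL2R

theorem mul_apply_eq (g h : SL2R) (i j : Fin 2) :
    (g * h) i j = g i 0 * h 0 j + g i 1 * h 1 j := by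
  simp [Matrix.mul_apply, Fin.sum_univ_two]

theorem inv_apply_eq (g : SL2R) :
    g⁻¹ 0 0 = g 1 1 ∧ g⁻¹ 0 1 = -g 0 1 ∧ g⁻¹ 1 0 = -g 1 0 ∧ g⁻¹ 1 1 = g 0 0 := by
  rw [Matrix.SpecialLinearGroup.SL2_inv_expl]
  simp

theorem det_eq (g : SL2R) : g 0 0 * g 1 1 - g 0 1 * g 1 0 = 1 := by
  rw [← Matrix.det_fin_two]
  exact g.det_coe

theorem ext_apply {g h : SL2R} (h00 : g 0 0 = h 0 0) (h01 : g 0 1 = h 0 1)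
    (h10 : g 1 0 = h 1 0) (h11 : g 1 1 = h 1 1) : g = h := by
  ext i j
  fin_cases i <;> fin_cases j <;> assumption

theorem eq_one_or_eq_neg_one {g : SL2R} (h01 : g 0 1 = 0) (h10 : g 1 0 = 0)
    (h : g 0 0 ^ 2 = 1) : g = 1 ∨ g = -1 := by
  have hdet := g.det_eq
  rw [h01, zero_mul, sub_zero] at hdet
  rcases mul_self_eq_one_iff.1 ((sq _).symm.trans h) with h0 | h0
  · left
    rw [h0, one_mul] at hdet
    exact ext_apply (by simp [h0]) (by simp [h01]) (by simp [h10]) (by simp [hdet])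
  · right
    rw [h0] at hdet
    exact ext_apply (by simp [h0]) (by simp [h01]) (by simp [h10]) (by simp; linarith)

theorem exists_conj_lower_left_eq_zero (a : SL2R) (ha : 4 ≤ (a 0 0 + a 1 1) ^ 2) :
    ∃ h : SL2R, (h⁻¹ * a * h) 1 0 = 0 := by
  by_cases hr : a 1 0 = 0
  · exact ⟨1, by simpa using hr⟩
  set t := a 0 0 + a 1 1 with ht
  set x := (t + Real.sqrt (t ^ 2 - 4)) / 2 with hx
  have hroot : x ^ 2 - t * x + 1 = 0 := by
    have := Real.sq_sqrt (sub_nonneg.2 ha)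
    rw [hx]
    linear_combination this / 4
  have hdet := a.det_eq
  let h : SL2R := ⟨!![x - a 1 1, -(a 1 0)⁻¹; a 1 0, 0], by
    rw [Matrix.det_fin_two_of]; field_simp; ring⟩
  refine ⟨h, ?_⟩
  obtain ⟨i1, i2, i3, i4⟩ := h.inv_apply_eq
  simp only [mul_apply_eq, i3, i4]
  simp only [h, Matrix.of_apply, Matrix.cons_val', Matrix.cons_val_zero, Matrix.cons_val_one,
    Matrix.cons_val_fin_one]
  linear_combination a 1 0 * hroot + a 1 0 * hdet + a 1 0 * x * ht

theorem exists_conj_upper_right_eq_zero (a : SL2R) (ha : a 1 0 = 0) (hne : a 0 0 ≠ a 1 1) :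
    ∃ h : SL2R, (h⁻¹ * a * h) 0 1 = 0 ∧ (h⁻¹ * a * h) 1 0 = 0 ∧
      (h⁻¹ * a * h) 0 0 = a 0 0 := by
  have hne' : a 1 1 - a 0 0 ≠ 0 := sub_ne_zero.2 hne.symm
  let h : SL2R := ⟨!![1, a 0 1 / (a 1 1 - a 0 0); 0, 1], by simp⟩
  refine ⟨h, ?_⟩
  obtain ⟨i1, i2, i3, i4⟩ := h.inv_apply_eq
  simp only [mul_apply_eq, i1, i2, i3, i4, ha]
  simp only [h, Matrix.of_apply, Matrix.cons_val', Matrix.cons_val_zero, Matrix.cons_val_one,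
    Matrix.cons_val_fin_one]
  refine ⟨?_, by ring, by ring⟩
  field_simp
  ring

theorem exists_conj_rotation (a : SL2R) (ha : (a 0 0 + a 1 1) ^ 2 < 4) :
    ∃ h : SL2R, (h⁻¹ * a * h) 0 0 = (h⁻¹ * a * h) 1 1 ∧
      (h⁻¹ * a * h) 0 1 = -(h⁻¹ * a * h) 1 0 ∧ (h⁻¹ * a * h) 1 0 ≠ 0 := by
  have hdet := a.det_eq
  have hr : a 1 0 ≠ 0 := by
    intro h0
    rw [h0, mul_zero, sub_zero] at hdet
    nlinarith [sq_nonneg (a 0 0 - a 1 1)]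
  obtain ⟨y, hy0, hy⟩ : ∃ y : ℝ, 0 < y ∧ y ^ 4 = (4 - (a 0 0 + a 1 1) ^ 2) / (4 * a 1 0 ^ 2) := by
    have hpos : 0 < (4 - (a 0 0 + a 1 1) ^ 2) / (4 * a 1 0 ^ 2) :=
      div_pos (by linarith) (by positivity)
    refine ⟨_, Real.sqrt_pos.2 (Real.sqrt_pos.2 hpos), ?_⟩
    rw [show 4 = 2 * 2 from rfl, pow_mul, Real.sq_sqrt (Real.sqrt_nonneg _), Real.sq_sqrt hpos.le]
  have hy' : 4 * a 1 0 ^ 2 * y ^ 4 = 4 - (a 0 0 + a 1 1) ^ 2 := by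
    rw [hy]; field_simp
  let h : SL2R := ⟨!![y, (a 0 0 - a 1 1) / (2 * a 1 0) / y; 0, y⁻¹], by
    rw [Matrix.det_fin_two_of]; field_simp; ring⟩
  refine ⟨h, ?_⟩
  obtain ⟨i1, i2, i3, i4⟩ := h.inv_apply_eq
  simp only [mul_apply_eq, i1, i2, i3, i4]
  simp only [h, Matrix.of_apply, Matrix.cons_val', Matrix.cons_val_zero, Matrix.cons_val_one,
    Matrix.cons_val_fin_one]
  refine ⟨?_, ?_, ?_⟩
  · field_simp
    ring
  · field_simp
    linear_combination hy' - 4 * hdet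
  · have : 0 < y ^ 2 := by positivity
    field_simp
    simpa using ⟨hy0.ne', hr⟩

end SL2R

/-- A subgroup `G` is a finite union of cosets of a cyclic subgroup of itself. -/
def IsVirtuallyCyclicSubgroup {X : Type*} [Group X] (G : Subgroup X) : Prop :=
  ∃ u ∈ G, ∃ S : Set X, S.Finite ∧ ∀ g ∈ G, ∃ s ∈ S, ∃ n : ℤ, g = s * u ^ n

theorem isVirtuallyCyclicSubgroup_of_finite {X : Type*} [Group X] {G : Subgroup X}
    (h : (G : Set X).Finite) : IsVirtuallyCyclicSubgroup G :=
  ⟨1, G.one_mem, G, h, fun g hg => ⟨g, hg, 0, by simp⟩⟩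

theorem mem_conj_smul_iff {X : Type*} [Group X] {G : Subgroup X} {h x : X} :
    x ∈ MulAut.conj h • G ↔ h⁻¹ * x * h ∈ G := by
  rw [Subgroup.mem_pointwise_smul_iff_inv_smul_mem, ← map_inv, MulAut.smul_def, MulAut.conj_apply,
    inv_inv]

theorem conj_mem_conj_inv_smul {X : Type*} [Group X] {G : Subgroup X} (h : X) {g : X}
    (hg : g ∈ G) : h⁻¹ * g * h ∈ MulAut.conj h⁻¹ • G := by
  rw [mem_conj_smul_iff]
  simpa [mul_assoc] using hg

theorem IsVirtuallyCyclicSubgroup.of_conj {X : Type*} [Group X] {G : Subgroup X} {h : X}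
    (hG : IsVirtuallyCyclicSubgroup (MulAut.conj h • G)) : IsVirtuallyCyclicSubgroup G := by
  obtain ⟨u, hu, S, hS, hGS⟩ := hG
  refine ⟨h⁻¹ * u * h, mem_conj_smul_iff.1 hu, (fun s => h⁻¹ * s * h) '' S, hS.image _,
    fun g hg => ?_⟩
  obtain ⟨s, hs, n, hn⟩ := hGS (h * g * h⁻¹) (mem_conj_smul_iff.2 (by simpa [mul_assoc] using hg))
  refine ⟨_, ⟨s, hs, rfl⟩, n, ?_⟩
  have h1 : (h⁻¹ * u * h) ^ n = h⁻¹ * u ^ n * h := by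
    simpa using conj_zpow (a := h⁻¹) (b := u) (i := n)
  rw [h1, ← mul_left_cancel_iff (a := h), ← mul_right_cancel_iff (a := h⁻¹), hn]
  group

open Topology in
/-- If a finite-index subgroup `D` of `G` admits a homomorphism to `ℝ` with discrete image and
finite kernel, then `G` is virtually cyclic. -/
theorem isVirtuallyCyclicSubgroup_of_additive {X : Type*} [Group X] {G D : Subgroup X}
    (hDG : D ≤ G) {T : Set X} (hT : T.Finite) (hGT : ∀ g ∈ G, ∃ t ∈ T, t⁻¹ * g ∈ D) (f : X → ℝ)
    (hf : ∀ g ∈ D, ∀ h ∈ D, f (g * h) = f g + f h)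
    (hiso : ∀ᶠ t in 𝓝 (0 : ℝ), ∀ g ∈ D, f g = t → t = 0)
    {S : Set X} (hS : S.Finite) (hker : ∀ g ∈ D, f g = 0 → g ∈ S) :
    IsVirtuallyCyclicSubgroup G := by
  let φ : D →* Multiplicative ℝ :=
    MonoidHom.mk' (fun g => Multiplicative.ofAdd (f g)) fun g h => by
      rw [← ofAdd_add, ← hf g g.2 h h.2]; rfl
  let A : AddSubgroup ℝ := Subgroup.toAddSubgroup' φ.range
  have hA : ∀ t, t ∈ A ↔ ∃ g ∈ D, f g = t := by
    intro t
    constructor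
    · rintro ⟨g, hg⟩
      exact ⟨g, g.2, hg⟩
    · rintro ⟨g, hg, rfl⟩
      exact ⟨⟨g, hg⟩, rfl⟩
  obtain ⟨ε, hε, hball⟩ := Metric.eventually_nhds_iff.1 hiso
  have hdisj : Disjoint (A : Set ℝ) (Set.Ioo 0 ε) := by
    rw [Set.disjoint_left]
    rintro t ht ⟨h0, h1⟩
    obtain ⟨g, hg, hgt⟩ := (hA t).1 ht
    exact h0.ne' (hball (by rwa [Real.dist_eq, sub_zero, abs_of_pos h0]) g hg hgt)
  obtain ⟨b, hb⟩ := AddSubgroup.cyclic_of_isolated_zero hε hdisj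
  have hbA : b ∈ A := hb ▸ AddSubgroup.mem_closure_singleton_self b
  obtain ⟨u, hu, rfl⟩ := (hA b).1 hbA
  have hzpow : ∀ n : ℤ, f (u ^ n) = n * f u := by
    intro n
    have h := map_zpow φ ⟨u, hu⟩ n
    simpa [φ] using congrArg Multiplicative.toAdd h
  refine ⟨u, hDG hu, Set.image2 (· * ·) T S, hT.image2 _ hS, fun g hg => ?_⟩
  obtain ⟨t, ht, htg⟩ := hGT g hg
  have hmem : f (t⁻¹ * g) ∈ A := (hA _).2 ⟨_, htg, rfl⟩
  rw [hb, AddSubgroup.mem_closure_singleton] at hmem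
  obtain ⟨n, hn⟩ := hmem
  have hun : u ^ (-n) ∈ D := D.zpow_mem hu _
  refine ⟨t * (t⁻¹ * g * u ^ (-n)), ⟨t, ht, _, hker _ (D.mul_mem htg hun) ?_, rfl⟩, n, ?_⟩
  · rw [hf _ htg _ hun, hzpow, ← hn]
    simp
  · group

namespace SL2R

open Topology

/-- The identity is isolated in `G`. -/
def IsolatedOne (G : Subgroup SL2R) : Prop :=
  ∀ᶠ X in 𝓝 (1 : Matrix (Fin 2) (Fin 2) ℝ), ∀ g ∈ G, (g : Matrix (Fin 2) (Fin 2) ℝ) = X → g = 1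

variable {G : Subgroup SL2R}

theorem IsolatedOne.conj (hG : IsolatedOne G) (h : SL2R) :
    IsolatedOne (MulAut.conj h • G) := by
  have hcont : Continuous fun X : Matrix (Fin 2) (Fin 2) ℝ => 
      ((h⁻¹ : SL2R) : Matrix (Fin 2) (Fin 2) ℝ) * X * (h : Matrix (Fin 2) (Fin 2) ℝ) :=
    (continuous_const.matrix_mul continuous_id).matrix_mul continuous_const
  have hlim := hcont.tendsto 1
  have h1 : ((h⁻¹ : SL2R) : Matrix (Fin 2) (Fin 2) ℝ) * 1 * (h : Matrix (Fin 2) (Fin 2) ℝ) = 1 := by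
    rw [mul_one, ← Matrix.SpecialLinearGroup.coe_mul, inv_mul_cancel,
      Matrix.SpecialLinearGroup.coe_one]
  rw [h1] at hlim
  filter_upwards [hlim.eventually hG] with X hX g hg hgX
  have h2 := hX _ (mem_conj_smul_iff.1 hg) (by simp [hgX])
  rw [mul_assoc, inv_mul_eq_one] at h2
  simpa using h2.symm

theorem IsolatedOne.eventually_eq_one (hG : IsolatedOne G) {ι : Type*} {l : Filter ι}
    {x : ι → Matrix (Fin 2) (Fin 2) ℝ} (hx : Filter.Tendsto x l (𝓝 1)) :
    ∀ᶠ i in l, ∀ g ∈ G, (g : Matrix (Fin 2) (Fin 2) ℝ) = x i → g = 1 :=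
  hx.eventually hG

theorem tendsto_matrix {ι : Type*} {l : Filter ι} {p q r s : ι → ℝ}
    (hp : Filter.Tendsto p l (𝓝 1)) (hq : Filter.Tendsto q l (𝓝 0))
    (hr : Filter.Tendsto r l (𝓝 0)) (hs : Filter.Tendsto s l (𝓝 1)) :
    Filter.Tendsto (fun i => !![p i, q i; r i, s i]) l (𝓝 1) := by
  rw [Matrix.one_fin_two]
  refine tendsto_pi_nhds.2 fun i => tendsto_pi_nhds.2 fun j => ?_
  fin_cases i <;> fin_cases j <;> simpa

theorem coe_eq_of {g : SL2R} {p q r s : ℝ} (hp : g 0 0 = p) (hq : g 0 1 = q) (hr : g 1 0 = r)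
    (hs : g 1 1 = s) : (g : Matrix (Fin 2) (Fin 2) ℝ) = !![p, q; r, s] := by
  rw [← hp, ← hq, ← hr, ← hs]
  exact Matrix.eta_fin_two _

/-- A discrete subgroup all of whose elements are rotations is finite. -/
theorem IsolatedOne.finite_of_rotation (hG : IsolatedOne G)
    (hrot : ∀ g ∈ G, g 0 0 = g 1 1 ∧ g 0 1 = -g 1 0) : (G : Set SL2R).Finite := by
  by_contra hinf
  have := Set.infinite_coe_iff.2 hinf
  let x : ℕ ↪ G := Infinite.natEmbedding G
  let v : ℕ → ℝ × ℝ := fun n => ((x n : SL2R) 0 0, (x n : SL2R) 1 0)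
  have hdet : ∀ n, (v n).1 * (v n).1 + (v n).2 * (v n).2 = 1 := by
    intro n
    obtain ⟨h1, h2⟩ := hrot _ (x n).2
    have h3 := (x n : SL2R).det_eq
    rw [h2, ← h1] at h3
    linarith
  have hmem : ∀ n, v n ∈ Set.Icc (-1 : ℝ) 1 ×ˢ Set.Icc (-1 : ℝ) 1 := by
    intro n
    have h1 := hdet n
    constructor <;> rw [Set.mem_Icc, ← abs_le, abs_le_one_iff_mul_self_le_one] <;>
      nlinarith [mul_self_nonneg (v n).1, mul_self_nonneg (v n).2]
  obtain ⟨w, -, φ, hφ, hlim⟩ := (isCompact_Icc.prod isCompact_Icc).tendsto_subseq hmem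
  have ha := (continuous_fst.tendsto w).comp hlim
  have hc := (continuous_snd.tendsto w).comp hlim
  have ha' := ha.comp (Filter.tendsto_add_atTop_nat 1)
  have hc' := hc.comp (Filter.tendsto_add_atTop_nat 1)
  have hw : w.1 * w.1 + w.2 * w.2 = 1 :=
    tendsto_nhds_unique ((ha.mul ha).add (hc.mul hc))
      (tendsto_const_nhds.congr fun n => (hdet (φ n)).symm)
  have hdiag := (ha.mul ha').add (hc.mul hc')
  have hoff := (ha.mul hc').sub (hc.mul ha')
  rw [hw] at hdiag
  rw [mul_comm w.2, sub_self] at hoff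
  obtain ⟨n, hn⟩ := (hG.eventually_eq_one
    (tendsto_matrix hdiag (by simpa using hoff.neg) hoff hdiag)).exists
  have h1 := hn ((x (φ n) : SL2R)⁻¹ * x (φ (n + 1))) (G.mul_mem (G.inv_mem (x _).2) (x _).2) (by
    obtain ⟨i1, i2, i3, i4⟩ := (x (φ n) : SL2R).inv_apply_eq
    obtain ⟨j1, j2⟩ := hrot _ (x (φ n)).2
    obtain ⟨k1, k2⟩ := hrot _ (x (φ (n + 1))).2
    apply coe_eq_of <;>
      simp only [mul_apply_eq, i1, i2, i3, i4, j2, k2, ← j1, ← k1, v, Function.comp] <;> ring)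
  rw [inv_mul_eq_one] at h1
  have h2 := hφ.injective (x.injective (Subtype.ext h1))
  omega

theorem trace_conj (g h : SL2R) :
    (h⁻¹ * g * h) 0 0 + (h⁻¹ * g * h) 1 1 = g 0 0 + g 1 1 := by
  obtain ⟨i1, i2, i3, i4⟩ := h.inv_apply_eq
  simp only [mul_apply_eq, i1, i2, i3, i4]
  linear_combination (g 0 0 + g 1 1) * h.det_eq

theorem trace_commutator_rotation (g h : SL2R) (h0 : g 0 0 = g 1 1) (h1 : g 0 1 = -g 1 0) :
    (g * h * g⁻¹ * h⁻¹) 0 0 + (g * h * g⁻¹ * h⁻¹) 1 1 =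
      2 + g 1 0 ^ 2 * ((h 0 0 - h 1 1) ^ 2 + (h 0 1 + h 1 0) ^ 2) := by
  obtain ⟨i1, i2, i3, i4⟩ := g.inv_apply_eq
  obtain ⟨j1, j2, j3, j4⟩ := h.inv_apply_eq
  have hg := g.det_eq
  have hh := h.det_eq
  simp only [mul_apply_eq, i1, i2, i3, i4, j1, j2, j3, j4]
  rw [h0, h1] at hg ⊢
  linear_combination 2 * (g 1 1 ^ 2 + g 1 0 ^ 2) * hh + 2 * hg

/-- A discrete subgroup without hyperbolic elements but with an elliptic rotation about `i` is
finite. -/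
theorem IsolatedOne.finite_of_elliptic (hG : IsolatedOne G)
    (hle : ∀ g ∈ G, (g 0 0 + g 1 1) ^ 2 ≤ 4) {a : SL2R} (ha : a ∈ G) (h0 : a 0 0 = a 1 1)
    (h1 : a 0 1 = -a 1 0) (h2 : a 1 0 ≠ 0) : (G : Set SL2R).Finite := by
  refine hG.finite_of_rotation fun g hg => ?_
  have htr := hle _ (G.mul_mem (G.mul_mem (G.mul_mem ha hg) (G.inv_mem ha)) (G.inv_mem hg))
  rw [trace_commutator_rotation _ _ h0 h1] at htr
  have hs : 0 < a 1 0 ^ 2 := by positivity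
  generalize hx : g 0 0 - g 1 1 = x at htr
  generalize hy : g 0 1 + g 1 0 = y at htr
  have hQ : x ^ 2 + y ^ 2 ≤ 0 := by
    by_contra! hpos
    nlinarith [mul_pos hs hpos]
  have hx0 : x = 0 := pow_eq_zero_iff two_ne_zero |>.1 (by nlinarith [sq_nonneg x, sq_nonneg y])
  have hy0 : y = 0 := pow_eq_zero_iff two_ne_zero |>.1 (by nlinarith [sq_nonneg x, sq_nonneg y])
  exact ⟨by linarith, by linarith⟩

/-- A discrete subgroup without hyperbolic elements but with a nontrivial upper triangular parabolic
element is virtually cyclic. -/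
theorem IsolatedOne.isVirtuallyCyclicSubgroup_of_parabolic (hG : IsolatedOne G)
    (hle : ∀ g ∈ G, (g 0 0 + g 1 1) ^ 2 ≤ 4) {q : SL2R} (hq : q ∈ G) (hlow : q 1 0 = 0)
    (hup : q 0 1 ≠ 0) : IsVirtuallyCyclicSubgroup G := by
  have hdiag : ∀ g ∈ G, g 1 0 = 0 → g 0 0 = g 1 1 ∧ g 0 0 ^ 2 = 1 := by
    intro g hg hg0
    have hdet := g.det_eq
    rw [hg0, mul_zero, sub_zero] at hdet
    have h1 := hle g hg
    have h2 : (g 0 0 - g 1 1) ^ 2 = 0 := le_antisymm (by linarith) (sq_nonneg _)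
    have h3 : g 0 0 = g 1 1 := sub_eq_zero.1 (pow_eq_zero_iff two_ne_zero |>.1 h2)
    exact ⟨h3, by rw [sq]; nth_rewrite 2 [h3]; exact hdet⟩
  obtain ⟨hq1, hq2⟩ := hdiag q hq hlow
  have hpow : ∀ n : ℕ, ((q * q) ^ n) 0 0 = 1 ∧ ((q * q) ^ n) 0 1 = n * (2 * q 0 0 * q 0 1) ∧
      ((q * q) ^ n) 1 0 = 0 ∧ ((q * q) ^ n) 1 1 = 1 := by
    intro n
    induction n with
    | zero => simp
    | succ k ih =>
      obtain ⟨i1, i2, i3, i4⟩ := ih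
      rw [pow_succ]
      generalize (q * q) ^ k = v at *
      simp only [mul_apply_eq, i1, i2, i3, i4, hlow, ← hq1]
      push_cast
      exact ⟨by linear_combination hq2, by linear_combination (k * 2 * q 0 0 * q 0 1) * hq2,
        by ring, by linear_combination hq2⟩
  have hall : ∀ g ∈ G, g 1 0 = 0 := by
    intro g hg
    by_contra hg0
    set b := 2 * q 0 0 * q 0 1 * g 1 0 with hb
    have hb0 : 0 < |b| := by
      have : q 0 0 ≠ 0 := by rintro h0; simp [h0] at hq2
      positivity
    obtain ⟨n, hn⟩ := exists_nat_gt (4 / |b|)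
    rw [div_lt_iff₀ hb0] at hn
    have h1 := hle _ (G.mul_mem (G.pow_mem (G.mul_mem hq hq) n)
      hg)
    have h2 := hle _ hg
    obtain ⟨i1, i2, i3, i4⟩ := hpow n
    generalize (q * q) ^ n = v at *
    simp only [mul_apply_eq, i1, i2, i3, i4] at h1
    have h3 : |g 0 0 + g 1 1| ≤ 2 := abs_le_of_sq_le_sq (by linarith) (by norm_num)
    have h4 : |g 0 0 + g 1 1 + n * b| ≤ 2 :=
      abs_le_of_sq_le_sq (by rw [hb]; linarith) (by norm_num)
    have h5 : |n * b| ≤ 4 := by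
      have := abs_sub (g 0 0 + g 1 1 + n * b) (g 0 0 + g 1 1)
      rw [add_sub_cancel_left] at this
      linarith
    rw [abs_mul, Nat.abs_cast] at h5
    linarith
  refine isVirtuallyCyclicSubgroup_of_additive le_rfl (Set.finite_singleton 1)
    (fun g hg => ⟨1, rfl, by simpa using hg⟩) (fun g => g 0 1 * g 0 0) ?_ ?_
    (Set.toFinite {1, -1}) ?_
  · intro g hg k hk
    obtain ⟨g1, g2⟩ := hdiag g hg (hall g hg)
    obtain ⟨k1, k2⟩ := hdiag k hk (hall k hk)
    simp only [mul_apply_eq, hall k hk, ← k1]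
    linear_combination (k 0 1 * k 0 0) * g2 + (g 0 1 * g 0 0) * k2
  · have hlim : Filter.Tendsto (fun t : ℝ => !![1, 2 * t; 0, 1]) (𝓝 0) (𝓝 1) :=
      tendsto_matrix tendsto_const_nhds
        (by simpa using (continuous_const_mul (2 : ℝ)).tendsto 0) tendsto_const_nhds
        tendsto_const_nhds
    filter_upwards [hG.eventually_eq_one hlim] with t ht g hg hgt
    obtain ⟨g1, g2⟩ := hdiag g hg (hall g hg)
    have hsq : ((g * g : SL2R) : Matrix (Fin 2) (Fin 2) ℝ) = !![1, 2 * t; 0, 1] := by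
      apply coe_eq_of <;> simp only [mul_apply_eq, hall g hg, ← g1] <;> linarith
    have h1 := ht _ (G.mul_mem hg hg) hsq
    rw [h1] at hsq
    have h2 := congrFun (congrFun hsq 0) 1
    simpa using h2
  · intro g hg hg0
    obtain ⟨g1, g2⟩ := hdiag g hg (hall g hg)
    have h1 : g 0 0 ≠ 0 := by rintro h0; simp [h0] at g2
    exact eq_one_or_eq_neg_one ((mul_eq_zero.1 hg0).resolve_right h1) (hall g hg) g2

/-- A discrete subgroup of `SL(2, ℝ)` without hyperbolic elements is virtually cyclic. -/
theorem IsolatedOne.exists_hyperbolic (hG : IsolatedOne G)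
    (hvc : ¬ IsVirtuallyCyclicSubgroup G) : ∃ g ∈ G, 4 < (g 0 0 + g 1 1) ^ 2 := by
  by_contra! hle
  refine hvc ?_
  have hconj : ∀ h : SL2R, ∀ g ∈ MulAut.conj h⁻¹ • G, (g 0 0 + g 1 1) ^ 2 ≤ 4 := by
    intro h g hg
    have h1 := hle _ (mem_conj_smul_iff.1 hg)
    rwa [trace_conj] at h1
  by_cases hell : ∃ a ∈ G, (a 0 0 + a 1 1) ^ 2 < 4
  · obtain ⟨a, ha, hat⟩ := hell
    obtain ⟨h, h0, h1, h2⟩ := a.exists_conj_rotation hat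
    exact IsVirtuallyCyclicSubgroup.of_conj (isVirtuallyCyclicSubgroup_of_finite
      ((hG.conj h⁻¹).finite_of_elliptic (hconj h) (conj_mem_conj_inv_smul h ha) h0 h1 h2))
  push Not at hell
  by_cases hpar : ∃ p ∈ G, p ≠ 1 ∧ p ≠ -1
  · obtain ⟨p, hp, hp1, hp2⟩ := hpar
    obtain ⟨h, hlow⟩ := p.exists_conj_lower_left_eq_zero (hell p hp)
    have hmem := conj_mem_conj_inv_smul h hp
    refine IsVirtuallyCyclicSubgroup.of_conj ((hG.conj h⁻¹).isVirtuallyCyclicSubgroup_of_parabolic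
      (hconj h) hmem hlow fun hup => ?_)
    have htr := hconj h _ hmem
    have hdet := (h⁻¹ * p * h).det_eq
    rw [hlow, mul_zero, sub_zero] at hdet
    have hsq : ((h⁻¹ * p * h) 0 0 - (h⁻¹ * p * h) 1 1) ^ 2 = 0 :=
      le_antisymm (by linarith) (sq_nonneg _)
    have heq := sub_eq_zero.1 (pow_eq_zero_iff two_ne_zero |>.1 hsq)
    rcases eq_one_or_eq_neg_one hup hlow (by rw [sq]; nth_rewrite 2 [heq]; exact hdet) with h1 | h1
    · rw [mul_assoc, inv_mul_eq_one] at h1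
      exact hp1 (by simpa using h1.symm)
    · rw [mul_assoc, inv_mul_eq_iff_eq_mul] at h1
      refine hp2 ((mul_left_inj h).1 ?_)
      rw [h1]
      simp
  · push Not at hpar
    refine isVirtuallyCyclicSubgroup_of_finite ((Set.toFinite {1, -1}).subset fun g hg => ?_)
    by_cases h1 : g = 1
    · exact Or.inl h1
    · exact Or.inr (hpar g hg h1)

variable {G : Subgroup SL2R}

/-- A discrete group of diagonal and antidiagonal matrices is virtually cyclic. -/
theorem IsolatedOne.isVirtuallyCyclicSubgroup_of_monomial (hG : IsolatedOne G)
    (h : ∀ g ∈ G, (g 0 1 = 0 ∧ g 1 0 = 0) ∨ (g 0 0 = 0 ∧ g 1 1 = 0)) :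
    IsVirtuallyCyclicSubgroup G := by
  let D : Subgroup SL2R :=
    { carrier := {g | g ∈ G ∧ g 0 1 = 0 ∧ g 1 0 = 0}
      mul_mem' := by
        rintro g k ⟨hg, g1, g2⟩ ⟨hk, k1, k2⟩
        exact ⟨G.mul_mem hg hk, by simp only [mul_apply_eq, g1, k1]; ring,
          by simp only [mul_apply_eq, g2, k2]; ring⟩
      one_mem' := ⟨G.one_mem, by simp, by simp⟩
      inv_mem' := by
        rintro g ⟨hg, g1, g2⟩
        obtain ⟨-, i2, i3, -⟩ := g.inv_apply_eq
        exact ⟨G.inv_mem hg, by rw [i2, g1, neg_zero], by rw [i3, g2, neg_zero]⟩ }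
  have hD : ∀ {g}, g ∈ D ↔ g ∈ G ∧ g 0 1 = 0 ∧ g 1 0 = 0 := Iff.rfl
  have hDdet : ∀ g ∈ D, g 0 0 * g 1 1 = 1 := by
    intro g hg
    have := g.det_eq
    rwa [(hD.1 hg).2.1, zero_mul, sub_zero] at this
  have hD0 : ∀ g ∈ D, g 0 0 ≠ 0 := fun g hg => left_ne_zero_of_mul_eq_one (hDdet g hg)
  obtain ⟨T, hT, hGT⟩ : ∃ T : Set SL2R, T.Finite ∧ ∀ g ∈ G, ∃ t ∈ T, t⁻¹ * g ∈ D := by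
    by_cases hanti : ∃ s ∈ G, s 0 0 = 0 ∧ s 1 1 = 0
    · obtain ⟨s, hs, s1, s2⟩ := hanti
      refine ⟨{1, s}, Set.toFinite _, fun g hg => ?_⟩
      rcases h g hg with hg' | ⟨g1, g2⟩
      · exact ⟨1, Or.inl rfl, by simpa using hD.2 ⟨hg, hg'⟩⟩
      · refine ⟨s, Or.inr rfl, hD.2 ⟨G.mul_mem (G.inv_mem hs) hg, ?_, ?_⟩⟩ <;>
          obtain ⟨i1, i2, i3, i4⟩ := s.inv_apply_eq <;>
          simp [mul_apply_eq, i1, i2, i3, i4, s1, s2, g1, g2]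
    · push Not at hanti
      refine ⟨{1}, Set.toFinite _, fun g hg => ⟨1, rfl, ?_⟩⟩
      rcases h g hg with hg' | ⟨g1, g2⟩
      · simpa using hD.2 ⟨hg, hg'⟩
      · exact absurd g2 (hanti g hg g1)
  refine isVirtuallyCyclicSubgroup_of_additive (fun g hg => (hD.1 hg).1) hT hGT
    (fun g => Real.log (g 0 0)) ?_ ?_ (Set.toFinite {1, -1}) ?_
  · intro g hg k hk
    rw [mul_apply_eq, (hD.1 hg).2.1, zero_mul, add_zero, Real.log_mul (hD0 g hg) (hD0 k hk)]
  · have h1 : Filter.Tendsto (fun t : ℝ => Real.exp (2 * t)) (𝓝 0) (𝓝 1) := by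
      have : Continuous fun t : ℝ => Real.exp (2 * t) := by fun_prop
      simpa using this.tendsto 0
    have h2 : Filter.Tendsto (fun t : ℝ => (Real.exp (2 * t))⁻¹) (𝓝 0) (𝓝 1) := by
      simpa using h1.inv₀ one_ne_zero
    filter_upwards [hG.eventually_eq_one
      (tendsto_matrix h1 tendsto_const_nhds tendsto_const_nhds h2)] with t ht g hg hgt
    obtain ⟨hgG, g1, g2⟩ := hD.1 hg
    have hexp : g 0 0 * g 0 0 = Real.exp (2 * t) := by
      rw [two_mul, Real.exp_add, ← hgt, Real.exp_log_eq_abs (hD0 g hg), abs_mul_abs_self]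
    have hsq : ((g * g : SL2R) : Matrix (Fin 2) (Fin 2) ℝ) =
        !![Real.exp (2 * t), 0; 0, (Real.exp (2 * t))⁻¹] := by
      rw [← hexp]
      apply coe_eq_of <;> simp only [mul_apply_eq, g1, g2]
      · ring
      · ring
      · ring
      · rw [mul_zero, zero_add]
        exact eq_inv_of_mul_eq_one_right (by
          linear_combination (g 0 0 * g 1 1 + 1) * hDdet g hg)
    rw [ht _ (G.mul_mem hgG hgG) hsq] at hsq
    have h3 := congrFun (congrFun hsq 0) 0
    have h4 : Real.exp (2 * t) = 1 := by simpa using h3.symm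
    simpa using h4
  · intro g hg hg0
    obtain ⟨hgG, g1, g2⟩ := hD.1 hg
    refine eq_one_or_eq_neg_one g1 g2 ?_
    rcases Real.log_eq_zero.1 hg0 with h0 | h0 | h0
    · exact absurd h0 (hD0 g hg)
    · rw [h0]; norm_num
    · rw [h0]; norm_num

theorem pow_diag {a : SL2R} (h01 : a 0 1 = 0) (h10 : a 1 0 = 0) (n : ℕ) :
    (a ^ n) 0 0 = a 0 0 ^ n ∧ (a ^ n) 0 1 = 0 ∧ (a ^ n) 1 0 = 0 ∧ (a ^ n) 1 1 = a 1 1 ^ n := by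
  induction n with
  | zero => simp
  | succ k ih =>
    obtain ⟨i1, i2, i3, i4⟩ := ih
    rw [pow_succ]
    generalize a ^ k = v at *
    simp only [mul_apply_eq, i1, i2, i3, i4, h01, h10]
    refine ⟨?_, ?_, ?_, ?_⟩ <;> ring

theorem tendsto_mul_sq_pow (b : ℝ) {y : ℝ} (hy : |y| < 1) :
    Filter.Tendsto (fun n : ℕ => b * (y ^ n * y ^ n)) Filter.atTop (𝓝 0) := by
  have h := tendsto_pow_atTop_nhds_zero_of_abs_lt_one hy
  simpa using (h.mul h).const_mul b

/-- In a discrete group, a parabolic element does not share its fixed point `∞` with a diagonal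
hyperbolic element. -/
theorem IsolatedOne.upper_right_eq_zero (hG : IsolatedOne G) {a : SL2R} (ha : a ∈ G)
    (h01 : a 0 1 = 0) (h10 : a 1 0 = 0) (hlt : |a 1 1| < 1) {g : SL2R} (hg : g ∈ G)
    (hg0 : g 1 0 = 0) : g 0 1 = 0 := by
  have hadet := a.det_eq
  have hgdet := g.det_eq
  rw [h01, zero_mul, sub_zero] at hadet
  rw [hg0, mul_zero, sub_zero] at hgdet
  set u := g⁻¹ * (a⁻¹ * g * a) with hu
  have huG : u ∈ G := G.mul_mem (G.inv_mem hg) (G.mul_mem (G.mul_mem (G.inv_mem ha) hg) ha)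
  obtain ⟨u1, u2, u3, u4⟩ : u 0 0 = 1 ∧ u 0 1 = g 1 1 * g 0 1 * (a 1 1 ^ 2 - 1) ∧ u 1 0 = 0 ∧
      u 1 1 = 1 := by
    obtain ⟨i1, i2, i3, i4⟩ := g.inv_apply_eq
    obtain ⟨j1, j2, j3, j4⟩ := a.inv_apply_eq
    simp only [hu, mul_apply_eq, i1, i2, i3, i4, j1, j2, j3, j4, h01, h10, hg0]
    exact ⟨by linear_combination hgdet + g 0 0 * g 1 1 * hadet,
      by linear_combination -g 0 1 * g 1 1 * hadet, by ring,
      by linear_combination hgdet + g 0 0 * g 1 1 * hadet⟩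
  obtain ⟨n, hn⟩ := (hG.eventually_eq_one (tendsto_matrix tendsto_const_nhds
    (tendsto_mul_sq_pow (u 0 1) hlt) tendsto_const_nhds tendsto_const_nhds)).exists
  have h1 := hn _ (G.mul_mem (G.mul_mem (G.inv_mem (G.pow_mem ha n)) huG) (G.pow_mem ha n)) (by
    obtain ⟨i1, i2, i3, i4⟩ := (a ^ n).inv_apply_eq
    obtain ⟨j1, j2, j3, j4⟩ := pow_diag h01 h10 n
    have hd : a 0 0 ^ n * a 1 1 ^ n = 1 := by rw [← mul_pow, hadet, one_pow]
    apply coe_eq_of <;>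
      simp only [mul_apply_eq, i1, i2, i3, i4, j1, j2, j3, j4, u1, u3, u4]
    · linear_combination hd
    · ring
    · ring
    · linear_combination hd)
  have h2 : u = 1 := by
    rw [mul_assoc, inv_mul_eq_one] at h1
    simpa using h1.symm
  have h3 : u 0 1 = 0 := by rw [h2]; simp
  rw [u2] at h3
  have h4 : g 1 1 ≠ 0 := right_ne_zero_of_mul_eq_one hgdet
  have h5 : a 1 1 ^ 2 - 1 ≠ 0 := by
    have := (sq_lt_one_iff_abs_lt_one _).2 hlt
    linarith
  simpa [h4, h5] using h3

/-- The Weyl element. -/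
def weyl : SL2R := ⟨!![0, -1; 1, 0], by simp⟩

theorem weyl_conj_apply (g : SL2R) : (weyl⁻¹ * g * weyl) 0 0 = g 1 1 ∧
    (weyl⁻¹ * g * weyl) 0 1 = -g 1 0 ∧ (weyl⁻¹ * g * weyl) 1 0 = -g 0 1 ∧
    (weyl⁻¹ * g * weyl) 1 1 = g 0 0 := by
  obtain ⟨i1, i2, i3, i4⟩ := weyl.inv_apply_eq
  simp only [mul_apply_eq, i1, i2, i3, i4]
  simp [weyl]

theorem IsolatedOne.lower_left_eq_zero (hG : IsolatedOne G) {a : SL2R} (ha : a ∈ G)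
    (h01 : a 0 1 = 0) (h10 : a 1 0 = 0) (hlt : |a 1 1| < 1) {g : SL2R} (hg : g ∈ G)
    (hg0 : g 0 1 = 0) : g 1 0 = 0 := by
  obtain ⟨i1, i2, i3, i4⟩ := a.inv_apply_eq
  obtain ⟨-, w2, w3, w4⟩ := weyl_conj_apply a⁻¹
  obtain ⟨-, v2, v3, -⟩ := weyl_conj_apply g
  have h := (hG.conj weyl⁻¹).upper_right_eq_zero
    (conj_mem_conj_inv_smul weyl (G.inv_mem ha)) (by rw [w2, i3, h10]; simp)
    (by rw [w3, i2, h01]; simp) (by rwa [w4, i1]) (conj_mem_conj_inv_smul weyl hg)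
    (by rw [v3, hg0, neg_zero])
  rwa [v2, neg_eq_zero] at h

/-- A discrete, not virtually cyclic group containing a diagonal hyperbolic element contains an
element moving both fixed points `0`, `∞` off `{0, ∞}`. -/
theorem IsolatedOne.exists_entries_ne_zero (hG : IsolatedOne G)
    (hvc : ¬ IsVirtuallyCyclicSubgroup G) {a : SL2R} (ha : a ∈ G)
    (h01 : a 0 1 = 0) (h10 : a 1 0 = 0) (hlt : |a 1 1| < 1) :
    ∃ g ∈ G, g 0 0 * g 1 1 ≠ 0 ∧ g 0 1 * g 1 0 ≠ 0 := by
  by_contra! hcon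
  refine hvc (hG.isVirtuallyCyclicSubgroup_of_monomial fun g hg => ?_)
  by_cases g01 : g 0 1 = 0
  · exact Or.inl ⟨g01, hG.lower_left_eq_zero ha h01 h10 hlt hg g01⟩
  by_cases g10 : g 1 0 = 0
  · exact Or.inl ⟨hG.upper_right_eq_zero ha h01 h10 hlt hg g10, g10⟩
  right
  have hprod : g 0 0 * g 1 1 = 0 := by
    by_contra h0
    exact (mul_ne_zero g01 g10) (hcon g hg h0)
  have hadet := a.det_eq
  rw [h01, zero_mul, sub_zero] at hadet
  have hne : a 0 0 - a 1 1 ≠ 0 := by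
    have := (sq_lt_one_iff_abs_lt_one _).2 hlt
    intro h0
    rw [sub_eq_zero.1 h0] at hadet
    nlinarith
  have hk : g * a * g⁻¹ ∈ G := G.mul_mem (G.mul_mem hg ha) (G.inv_mem hg)
  obtain ⟨k1, k2⟩ : (g * a * g⁻¹) 0 1 = -(g 0 0 * g 0 1 * (a 0 0 - a 1 1)) ∧
      (g * a * g⁻¹) 1 0 = g 1 0 * g 1 1 * (a 0 0 - a 1 1) := by
    obtain ⟨i1, i2, i3, i4⟩ := g.inv_apply_eq
    simp only [mul_apply_eq, i1, i2, i3, i4, h01, h10]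
    constructor <;> ring
  rcases mul_eq_zero.1 hprod with h0 | h0
  · refine ⟨h0, ?_⟩
    have h := hG.lower_left_eq_zero ha h01 h10 hlt hk (by rw [k1, h0]; ring)
    rw [k2] at h
    simpa [g10, hne] using h
  · refine ⟨?_, h0⟩
    have h := hG.upper_right_eq_zero ha h01 h10 hlt hk (by rw [k2, h0]; ring)
    rw [k1] at h
    simpa [g01, hne] using h

theorem exists_translationLength_eq {g : SL2R} (hg : 4 < (g 0 0 + g 1 1) ^ 2) :
    ∃ x : ℝ, 1 < x ∧ x + x⁻¹ = |g 0 0 + g 1 1| ∧ translationLength g = 2 * Real.log x := by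
  have ht : 2 < |g 0 0 + g 1 1| := by
    rw [← sq_abs] at hg
    nlinarith [abs_nonneg (g 0 0 + g 1 1)]
  have hs := Real.sq_sqrt (sub_nonneg.2 hg.le)
  have hs0 := Real.sqrt_nonneg ((g 0 0 + g 1 1) ^ 2 - 4)
  refine ⟨(|g 0 0 + g 1 1| + Real.sqrt ((g 0 0 + g 1 1) ^ 2 - 4)) / 2, by linarith, ?_, ?_⟩
  · rw [← sq_abs (g 0 0 + g 1 1)] at hs hs0 ⊢
    generalize |g 0 0 + g 1 1| = t at *
    generalize Real.sqrt (t ^ 2 - 4) = s at *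
    have : t + s ≠ 0 := by linarith
    field_simp
    linear_combination hs
  · rw [translationLength, Matrix.trace_fin_two]

theorem translationLength_conj (g h : SL2R) :
    translationLength (h⁻¹ * g * h) = translationLength g := by
  simp only [translationLength, Matrix.trace_fin_two, trace_conj]

theorem translationLength_of_diag {a : SL2R} (h01 : a 0 1 = 0) (hlt : |a 1 1| < 1) :
    translationLength a = Real.log (a 0 0 ^ 2) ∧ 1 < a 0 0 ^ 2 ∧ 4 < (a 0 0 + a 1 1) ^ 2 := by
  have hadet := a.det_eq
  rw [h01, zero_mul, sub_zero] at hadet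
  have h1 := (sq_lt_one_iff_abs_lt_one _).2 hlt
  have h2 : a 0 0 ^ 2 * a 1 1 ^ 2 = 1 := by rw [← mul_pow, hadet, one_pow]
  have h3 : 1 < a 0 0 ^ 2 := by
    by_contra! h
    nlinarith [sq_nonneg (a 0 0), sq_nonneg (a 1 1)]
  have h4 : 4 < (a 0 0 + a 1 1) ^ 2 := by
    have : (a 0 0 - a 1 1) ≠ 0 := by
      intro h0
      rw [sub_eq_zero.1 h0] at h3
      linarith
    have : 0 < (a 0 0 - a 1 1) ^ 2 := by positivity
    linarith
  refine ⟨?_, h3, h4⟩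
  obtain ⟨x, hx, hxt, hxl⟩ := exists_translationLength_eq h4
  have hx0 : x ≠ 0 := by positivity
  have hsq : (x ^ 2 - a 0 0 ^ 2) * (x ^ 2 - a 1 1 ^ 2) = 0 := by
    have h5 : (x + x⁻¹) ^ 2 = a 0 0 ^ 2 + a 1 1 ^ 2 + 2 := by rw [hxt, sq_abs]; linarith
    field_simp at h5
    linear_combination h5 + h2
  have h6 : x ^ 2 = a 0 0 ^ 2 := by
    rcases mul_eq_zero.1 hsq with h | h
    · linarith
    · nlinarith
  rw [hxl, ← h6, Real.log_pow]
  norm_num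

/-- Two elements of `G` are hyperbolic with rationally independent translation lengths. -/
def HasIndependentLengths (G : Subgroup SL2R) : Prop :=
  ∃ g₁ ∈ G, ∃ g₂ ∈ G, 4 < (g₁ 0 0 + g₁ 1 1) ^ 2 ∧ 4 < (g₂ 0 0 + g₂ 1 1) ^ 2 ∧
    ∀ p q : ℚ, (p : ℝ) * translationLength g₁ + (q : ℝ) * translationLength g₂ = 0 →
      p = 0 ∧ q = 0

theorem HasIndependentLengths.of_conj {h : SL2R}
    (hG : HasIndependentLengths (MulAut.conj h • G)) : HasIndependentLengths G := by
  obtain ⟨g₁, hg₁, g₂, hg₂, ht₁, ht₂, hind⟩ := hG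
  refine ⟨_, mem_conj_smul_iff.1 hg₁, _, mem_conj_smul_iff.1 hg₂, ?_, ?_, ?_⟩
  · rwa [trace_conj]
  · rwa [trace_conj]
  · rwa [translationLength_conj, translationLength_conj]

theorem hasIndependentLengths_of_diag {a b : SL2R} (ha : a ∈ G) (hb : b ∈ G) (h01 : a 0 1 = 0)
    (h10 : a 1 0 = 0) (hlt : |a 1 1| < 1) (hb1 : b 0 0 * b 1 1 ≠ 0) (hb2 : b 0 1 * b 1 0 ≠ 0) :
    HasIndependentLengths G := by
  by_contra hcon
  obtain ⟨hla, hL, hta⟩ := translationLength_of_diag h01 hlt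
  have hadet := a.det_eq
  rw [h01, zero_mul, sub_zero] at hadet
  have hbdet := b.det_eq
  set L := a 0 0 ^ 2 with hLdef
  have hL0 : 0 < L := by positivity
  have hlog : 0 < Real.log L := Real.log_pos hL
  refine not_forall_exists_rat_rpow hL hb1 (fun h => hb2 (by linarith)) fun n hn => ?_
  set g := a ^ n * b * a ^ n * b⁻¹ with hg
  have hgG : g ∈ G := G.mul_mem (G.mul_mem (G.mul_mem (G.pow_mem ha n) hb) (G.pow_mem ha n))
    (G.inv_mem hb)
  have htr : g 0 0 + g 1 1 = b 0 0 * b 1 1 * (L ^ n + (L ^ n)⁻¹ - 2) + 2 := by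
    have hinv : (L ^ n)⁻¹ = (a 1 1 ^ n) ^ 2 := by
      refine inv_eq_of_mul_eq_one_right ?_
      rw [hLdef, ← pow_mul, ← pow_mul, mul_comm n, ← mul_pow, hadet, one_pow]
    have hLn : L ^ n = (a 0 0 ^ n) ^ 2 := by rw [hLdef, ← pow_mul, ← pow_mul, mul_comm]
    have hd : a 0 0 ^ n * a 1 1 ^ n = 1 := by rw [← mul_pow, hadet, one_pow]
    obtain ⟨i1, i2, i3, i4⟩ := b.inv_apply_eq
    obtain ⟨j1, j2, j3, j4⟩ := pow_diag h01 h10 n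
    rw [hinv, hLn]
    simp only [hg, mul_apply_eq, i1, i2, i3, i4, j1, j2, j3, j4]
    linear_combination -2 * b 0 1 * b 1 0 * hd + 2 * hbdet
  rw [← htr] at hn ⊢
  have hg4 : 4 < (g 0 0 + g 1 1) ^ 2 := by
    rw [← sq_abs]
    nlinarith
  obtain ⟨x, hx, hxt, hxl⟩ := exists_translationLength_eq hg4
  have hlogx : 0 < Real.log x := Real.log_pos hx
  rw [HasIndependentLengths] at hcon
  push Not at hcon
  obtain ⟨p, q, hpq, hne⟩ := hcon a ha g hgG hta hg4
  rw [hla, hxl] at hpq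
  have hq : q ≠ 0 := by
    intro hq
    have hp : p ≠ 0 := fun hp => hne hp hq
    simp [hq, hp, hlog.ne'] at hpq
  have hq' : (q : ℝ) ≠ 0 := by exact_mod_cast hq
  have hlogeq : Real.log x = ((-p / (2 * q) : ℚ) : ℝ) * Real.log L := by
    push_cast
    field_simp
    linarith
  have hrpow : L ^ ((-p / (2 * q) : ℚ) : ℝ) = x := by
    rw [Real.rpow_def_of_pos hL0, mul_comm, ← hlogeq, Real.exp_log (by positivity)]
  refine ⟨-p / (2 * q), ?_, by rw [hrpow, hxt]⟩
  rw [hlogeq] at hlogx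
  exact_mod_cast pos_of_mul_pos_left hlogx hlog.le

theorem IsolatedOne.hasIndependentLengths (hG : IsolatedOne G)
    (hvc : ¬ IsVirtuallyCyclicSubgroup G) : HasIndependentLengths G := by
  obtain ⟨c, hc, hct⟩ := hG.exists_hyperbolic hvc
  obtain ⟨h, hlow⟩ := c.exists_conj_lower_left_eq_zero hct.le
  have htr := hct
  rw [← trace_conj c h] at htr
  have hdet := (h⁻¹ * c * h).det_eq
  rw [hlow, mul_zero, sub_zero] at hdet
  obtain ⟨k, k01, k10, -⟩ := (h⁻¹ * c * h).exists_conj_upper_right_eq_zero hlow (fun heq => by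
    rw [heq] at htr hdet
    nlinarith)
  set a := k⁻¹ * (h⁻¹ * c * h) * k with ha
  have haG := conj_mem_conj_inv_smul k (conj_mem_conj_inv_smul h hc)
  have hG' := (hG.conj h⁻¹).conj k⁻¹
  have hvc' : ¬ IsVirtuallyCyclicSubgroup (MulAut.conj k⁻¹ • MulAut.conj h⁻¹ • G) :=
    fun hv => hvc hv.of_conj.of_conj
  rw [← ha] at haG
  refine HasIndependentLengths.of_conj (h := h⁻¹) (HasIndependentLengths.of_conj (h := k⁻¹) ?_)
  generalize MulAut.conj k⁻¹ • MulAut.conj h⁻¹ • G = G' at *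
  have hta : 4 < (a 0 0 + a 1 1) ^ 2 := by rwa [ha, trace_conj]
  have hadet := a.det_eq
  rw [k01, zero_mul, sub_zero] at hadet
  suffices key : ∀ a ∈ G', a 0 1 = 0 → a 1 0 = 0 → |a 1 1| < 1 → HasIndependentLengths G' by
    by_cases hlt : |a 1 1| < 1
    · exact key a haG k01 k10 hlt
    · obtain ⟨i1, i2, i3, i4⟩ := a.inv_apply_eq
      refine key a⁻¹ (G'.inv_mem haG) (by rw [i2, k01, neg_zero]) (by rw [i3, k10, neg_zero]) ?_
      rw [i4]
      by_contra! hge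
      push Not at hlt
      have h1 : |a 0 0| * |a 1 1| = 1 := by rw [← abs_mul, hadet, abs_one]
      have h2 : |a 0 0| = 1 := by nlinarith
      have h3 : |a 1 1| = 1 := by nlinarith
      have h4 := (abs_add_le (a 0 0) (a 1 1))
      rw [← sq_abs] at hta
      nlinarith [abs_nonneg (a 0 0 + a 1 1)]
  intro d hd h01 h10 hlt
  obtain ⟨b, hb, hb1, hb2⟩ := hG'.exists_entries_ne_zero hvc' hd h01 h10 hlt
  exact hasIndependentLengths_of_diag hd hb h01 h10 hlt hb1 hb2

end SL2R

open Topology in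
/-- The preimage in `SL(2, ℝ)` of a discrete subgroup of `PSL(2, ℝ)` is discrete. -/
theorem isolatedOne_comap (Γ : Subgroup PSL2R) [DiscreteTopology Γ] :
    SL2R.IsolatedOne (Γ.comap (QuotientGroup.mk' (Subgroup.center SL2R))) := by
  obtain ⟨V, hV, hVΓ⟩ := isOpen_induced_iff.1 (isOpen_discrete ({1} : Set Γ))
  have hopen : IsOpen ((QuotientGroup.mk : SL2R → PSL2R) ⁻¹' V) :=
    hV.preimage QuotientGroup.continuous_mk
  obtain ⟨U, hU, hUV⟩ := isOpen_induced_iff.1 hopen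
  have h1U : (1 : Matrix (Fin 2) (Fin 2) ℝ) ∈ U := by
    have h1 : (1 : SL2R) ∈ (QuotientGroup.mk : SL2R → PSL2R) ⁻¹' V := by
      have : (1 : Γ) ∈ (Subtype.val ⁻¹' V : Set Γ) := by rw [hVΓ]; rfl
      exact this
    rw [← hUV] at h1
    simpa using h1
  have hpos : ∀ᶠ X in 𝓝 (1 : Matrix (Fin 2) (Fin 2) ℝ), 0 < X 0 0 :=
    ((continuous_id.matrix_elem 0 0).tendsto _).eventually_const_lt (by simp)
  filter_upwards [hU.mem_nhds h1U, hpos] with X hX hX0 g hg hgX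
  subst hgX
  have hgV : (QuotientGroup.mk g : PSL2R) ∈ V := by
    have : g ∈ (QuotientGroup.mk : SL2R → PSL2R) ⁻¹' V := by rw [← hUV]; exact hX
    exact this
  have hg1 : (⟨QuotientGroup.mk g, hg⟩ : Γ) ∈ (Subtype.val ⁻¹' V : Set Γ) := hgV
  rw [hVΓ] at hg1
  have hcen : g ∈ Subgroup.center SL2R := (QuotientGroup.eq_one_iff g).1 (congrArg Subtype.val hg1)
  obtain ⟨r, hr, hrg⟩ := Matrix.SpecialLinearGroup.mem_center_iff.1 hcen
  have h00 : g 0 0 = r := by simp [← hrg]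
  rcases SL2R.eq_one_or_eq_neg_one (g := g) (by simp [← hrg]) (by simp [← hrg])
    (by rw [h00]; simpa using hr) with h | h
  · exact h
  · rw [h] at hX0
    norm_num at hX0

/-- A subgroup of a quotient with virtually cyclic preimage has a cyclic subgroup of finite
index. -/
theorem exists_isCyclic_finiteIndex {X : Type*} [Group X] {N : Subgroup X} [N.Normal]
    {Γ : Subgroup (X ⧸ N)} (h : IsVirtuallyCyclicSubgroup (Γ.comap (QuotientGroup.mk' N))) :
    ∃ H : Subgroup Γ, IsCyclic H ∧ H.FiniteIndex := by
  obtain ⟨u, hu, S, hS, hcov⟩ := h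
  let v : Γ := ⟨QuotientGroup.mk u, hu⟩
  refine ⟨Subgroup.zpowers v, inferInstance, ?_⟩
  have hrep : ∀ γ : Γ, ∃ s : S, ∃ n : ℤ,
      (γ : X ⧸ N) = (QuotientGroup.mk (s : X) : X ⧸ N) * (v : X ⧸ N) ^ n := by
    rintro ⟨γ, hγ⟩
    obtain ⟨g, rfl⟩ := QuotientGroup.mk_surjective γ
    obtain ⟨s, hs, n, rfl⟩ := hcov g hγ
    exact ⟨⟨s, hs⟩, n, by simp [v]⟩
  choose s n hsn using hrep
  have := hS.to_subtype
  have hinj : Function.Injective fun c : Γ ⧸ Subgroup.zpowers v => s c.out := by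
    intro c d hcd
    rw [← c.out_eq', ← d.out_eq', QuotientGroup.eq, Subgroup.mem_zpowers_iff]
    refine ⟨-n c.out + n d.out, Subtype.ext ?_⟩
    have h1 := hsn c.out
    have h2 := hsn d.out
    simp only at hcd
    rw [hcd] at h1
    rw [Subgroup.coe_mul, Subgroup.coe_inv, h1, h2, zpow_add, zpow_neg]
    push_cast
    group
  have := Finite.of_injective _ hinj
  exact Subgroup.finiteIndex_of_finite_quotient

/-- A non-elementary Fuchsian group contains two hyperbolic elements whose translation
lengths are linearly independent over `ℚ`. -/
theorem exists_rationally_independent_lengths (Γ : Subgroup PSL2R)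
    (hdisc : DiscreteTopology Γ)
    (hnonelem : ¬ ∃ H : Subgroup Γ, IsCyclic H ∧ H.FiniteIndex) :
    ∃ γ₁ ∈ Γ, ∃ γ₂ ∈ Γ, ∃ g₁ g₂ : SL2R,
      QuotientGroup.mk g₁ = γ₁ ∧ QuotientGroup.mk g₂ = γ₂ ∧
      2 < |Matrix.trace (g₁ : Matrix (Fin 2) (Fin 2) ℝ)| ∧
      2 < |Matrix.trace (g₂ : Matrix (Fin 2) (Fin 2) ℝ)| ∧
      ∀ p q : ℚ, (p : ℝ) * translationLength g₁ + (q : ℝ) * translationLength g₂ = 0 →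
        p = 0 ∧ q = 0 := by
  obtain ⟨g₁, hg₁, g₂, hg₂, ht₁, ht₂, hind⟩ := (isolatedOne_comap Γ).hasIndependentLengths
    fun h => hnonelem (exists_isCyclic_finiteIndex h)
  have habs : ∀ t : ℝ, 4 < t ^ 2 → 2 < |t| := fun t ht =>
    lt_of_pow_lt_pow_left₀ 2 (abs_nonneg t) (by rw [sq_abs]; linarith)
  exact ⟨_, hg₁, _, hg₂, g₁, g₂, rfl, rfl, by rw [Matrix.trace_fin_two]; exact habs _ ht₁,
    by rw [Matrix.trace_fin_two]; exact habs _ ht₂, hind⟩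
end

section
/- Let K ⊆ ℝ be a field that is a finitely generated extension of ℚ, let r ∈ K with r > 0 and r ≠ 1, and let t be a positive natural number. Then there are only finitely many rational numbers q with 0 < q < 1 such that r^q (the positive real power) has degree at most t over K, i.e., [K(r^q):K] ≤ t. -/
open IntermediateField algebraAdjoinAdjoin in
theorem finiteDimensional_algebraicClosure_of_essFiniteType (k E : Type*) [Field k] [Field E]
    [Algebra k E] [Algebra.EssFiniteType k E] : FiniteDimensional k (algebraicClosure k E) := by
  obtain ⟨s, hs⟩ := exists_isTranscendenceBasis k E
  let S := Algebra.adjoin k (Set.range ((↑) : s → E))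
  let F := IntermediateField.adjoin k (Set.range ((↑) : s → E))
  let M := algebraicClosure k E
  have : Algebra.EssFiniteType F E := .of_comp k F E
  have : Algebra.IsAlgebraic F E := hs.isAlgebraic_field
  have : Module.Finite F E := Algebra.finite_of_essFiniteType_of_isAlgebraic
  have : Algebra.IsAlgebraic k M.toSubalgebra := inferInstanceAs (Algebra.IsAlgebraic k M)
  have hM : AlgebraicIndependent M.toSubalgebra ((↑) : s → E) := hs.1.extendScalars _
  have hdisj : M.toSubalgebra.LinearDisjoint S := by
    refine .of_basis_right _ _ ((MvPolynomial.basisMonomials s k).map hs.1.aevalEquiv.toLinearEquiv) ?_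
    have h := (MvPolynomial.basisMonomials s M.toSubalgebra).linearIndependent.map'
      (MvPolynomial.aeval (R := M.toSubalgebra) ((↑) : s → E)).toLinearMap
      (LinearMap.ker_eq_bot.2 hM)
    have heq : (MvPolynomial.aeval (R := M.toSubalgebra) ((↑) : s → E)).toLinearMap ∘
        MvPolynomial.basisMonomials s M.toSubalgebra =
        S.val ∘ (MvPolynomial.basisMonomials s k).map hs.1.aevalEquiv.toLinearEquiv := by
      funext m
      simp [MvPolynomial.aeval_monomial]
    exact heq ▸ h
  have h1 : LinearIndependent S (M.val ∘ Module.Free.chooseBasis k M) :=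
    hdisj.linearIndependent_left_of_flat (Module.Free.chooseBasis k M).linearIndependent
  have h2 : LinearIndependent F (M.val ∘ Module.Free.chooseBasis k M) :=
    (LinearIndependent.iff_fractionRing S F).1 h1
  have : Finite (Module.Free.ChooseBasisIndex k M) := h2.finite
  exact Module.Finite.of_basis (Module.Free.chooseBasis k M)

open Polynomial in
theorem abs_coeff_zero_eq_pow_natDegree {F : Type*} [Field F] (f : F →+* ℝ) {p : F[X]}
    (hp : p.Monic) {a : F} {s : ℝ} (hs : 0 ≤ s) {n : ℕ} (hn : n ≠ 0) (ha : f a = s ^ n)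
    (hdvd : p ∣ X ^ n - C a) : |f (p.coeff 0)| = s ^ p.natDegree := by
  let g : F →+* ℂ := Complex.ofRealHom.comp f
  have hsp := IsAlgClosed.splits (p.map g)
  have h0 := hsp.coeff_zero_eq_prod_roots_of_monic (hp.map g)
  have hroot : ∀ z ∈ (p.map g).roots, ‖z‖ = s := by
    intro z hz
    have h1 : (p.map g).IsRoot z := isRoot_of_mem_roots hz
    have h2 : ((X ^ n - C a).map g).IsRoot z := h1.dvd (Polynomial.map_dvd g hdvd)
    have h3 : z ^ n = ((s : ℂ)) ^ n := by
      have : g a = (s : ℂ) ^ n := by simp [g, ha]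
      simpa [sub_eq_zero, this] using h2
    have h4 : ‖z‖ ^ n = s ^ n := by
      rw [← norm_pow, h3, norm_pow, Complex.norm_real, Real.norm_of_nonneg hs]
    exact (pow_left_inj₀ (norm_nonneg z) hs hn).1 h4
  have h5 : ‖(p.map g).coeff 0‖ = s ^ (p.map g).natDegree := by
    rw [h0, norm_mul, norm_pow, norm_neg, norm_one, one_pow, one_mul, hsp.natDegree_eq_card_roots]
    have : ‖(p.map g).roots.prod‖ = ((p.map g).roots.map norm).prod :=
      map_multiset_prod (normHom : ℂ →*₀ ℝ) _
    rw [this, Multiset.map_congr rfl hroot, Multiset.map_const', Multiset.prod_replicate]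
  rw [natDegree_map, coeff_map] at h5
  simpa [g] using h5

theorem RatFunc.dvd_of_pow_eq_X_pow {k : Type*} [Field k] {u : RatFunc k} {n m : ℕ}
    (h : u ^ n = RatFunc.X ^ m) : n ∣ m := by
  have hu (v : RatFunc k) (hv : v ≠ 0) (i : ℕ) : (v ^ i).intDegree = i * v.intDegree := by
    induction i with
    | zero => simp
    | succ i ih => rw [pow_succ, intDegree_mul (pow_ne_zero _ hv) hv, ih]; push_cast; ring
  rcases eq_or_ne n 0 with rfl | hn
  · have := congrArg intDegree h
    rw [hu X X_ne_zero] at this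
    simpa [eq_comm] using this
  have hu0 : u ≠ 0 := by
    rintro rfl
    rw [zero_pow hn] at h
    exact pow_ne_zero m X_ne_zero h.symm
  have := congrArg intDegree h
  rw [hu _ hu0, hu _ X_ne_zero, intDegree_X, mul_one] at this
  exact Int.natCast_dvd_natCast.1 ⟨_, this.symm⟩

theorem Real.rpow_ratCast_pow_den {x : ℝ} (hx : 0 ≤ x) {q : ℚ} (hq : 0 ≤ q) :
    (x ^ (q : ℝ)) ^ q.den = x ^ q.num.toNat := by
  have hnum : ((q.num.toNat : ℕ) : ℤ) = q.num := Int.toNat_of_nonneg (Rat.num_nonneg.2 hq)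
  have h : (q : ℝ) * q.den = (q.num.toNat : ℝ) := by
    have : q * q.den = (q.num.toNat : ℚ) := by
      rw [Rat.mul_den_eq_num]; exact_mod_cast hnum.symm
    exact_mod_cast this
  rw [← Real.rpow_mul_natCast hx, h, Real.rpow_natCast]

theorem Rat.finite_setOf_den_le (t D : ℕ) :
    {q : ℚ | 0 ≤ q ∧ q ≤ t ∧ q.den ≤ D}.Finite := by
  refine (((Set.finite_Iic (t * D)).prod (Set.finite_Iic D)).image
    fun x : ℕ × ℕ ↦ (x.1 / x.2 : ℚ)).subset ?_
  rintro q ⟨hq0, hqt, hqD⟩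
  have hnum : ((q.num.toNat : ℕ) : ℤ) = q.num := Int.toNat_of_nonneg (Rat.num_nonneg.2 hq0)
  have hq : q * q.den = (q.num.toNat : ℚ) := by
    rw [Rat.mul_den_eq_num]; exact_mod_cast hnum.symm
  refine ⟨(q.num.toNat, q.den), ⟨?_, hqD⟩, ?_⟩
  · have : (q.num.toNat : ℚ) ≤ t * D := by
      rw [← hq]
      have : (q.den : ℚ) ≤ D := by exact_mod_cast hqD
      gcongr
    exact_mod_cast this
  · simp only [← hq]
    field_simp [q.den_nz]

theorem finite_rat_rpow_mem_range_of_isAlgebraic {E : Type*} [Field E] [Algebra ℚ E]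
    [Algebra.EssFiniteType ℚ E] (f : E →+* ℝ) {r : E} (hr0 : 0 < f r) (hr1 : f r ≠ 1)
    (hr : IsAlgebraic ℚ r) (t : ℕ) :
    {q : ℚ | 0 ≤ q ∧ q ≤ t ∧ f r ^ (q : ℝ) ∈ f.range}.Finite := by
  let L := algebraicClosure ℚ E
  have : FiniteDimensional ℚ L := finiteDimensional_algebraicClosure_of_essFiniteType ℚ E
  have : NumberField L :=
    { to_finiteDimensional := by
        convert this
        exact (subsingleton_rat_module L).elim _ _ }
  let r' : L := ⟨r, mem_algebraicClosure_iff.2 hr⟩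
  obtain ⟨N, hN0, hN⟩ : ∃ y ≠ (0 : ℤ), IsIntegral ℤ (y • r') :=
    ((IsFractionRing.isAlgebraic_iff ℤ ℚ L).2
      (Algebra.IsAlgebraic.isAlgebraic (R := ℚ) r')).exists_integral_multiple
  let M : ℝ := 1 + ∑ φ : L →+* ℂ, ‖φ r'‖
  have hM (φ : L →+* ℂ) : ‖φ r'‖ ≤ M :=
    (Finset.single_le_sum (f := fun φ : L →+* ℂ ↦ ‖φ r'‖) (fun _ _ ↦ norm_nonneg _)
      (Finset.mem_univ φ)).trans (by simp [M])
  have hM1 : 1 ≤ M := le_add_of_nonneg_right (Finset.sum_nonneg fun _ _ ↦ norm_nonneg _)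
  have hT := NumberField.Embeddings.finite_of_norm_le L ℂ (‖(N : ℂ)‖ ^ t * M ^ t)
  refine ((hT.image fun x : L ↦ f x).preimage
    (f := fun q : ℚ ↦ (N : ℝ) ^ t * f r ^ (q : ℝ)) ?_).subset ?_
  · intro x _ y _ hxy
    have h1 := mul_left_cancel₀ (pow_ne_zero t (Int.cast_ne_zero.2 hN0)) hxy
    exact_mod_cast (Real.rpow_right_inj hr0 hr1).1 h1
  rintro q ⟨hq0, hqt, u, hu⟩
  have hpow : u ^ q.den = r ^ q.num.toNat := f.injective <| by
    rw [map_pow, hu, map_pow, Real.rpow_ratCast_pow_den hr0.le hq0]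
  have hnum : q.num.toNat ≤ t * q.den := by
    have h1 : ((q.num.toNat : ℕ) : ℤ) = q.num := Int.toNat_of_nonneg (Rat.num_nonneg.2 hq0)
    have h2 : q * q.den = (q.num.toNat : ℚ) := by
      rw [Rat.mul_den_eq_num]; exact_mod_cast h1.symm
    have h3 : (q.num.toNat : ℚ) ≤ t * q.den := by rw [← h2]; gcongr
    exact_mod_cast h3
  let u' : L := ⟨u, mem_algebraicClosure_iff.2 <|
    IsAlgebraic.of_pow q.den_pos (hpow ▸ hr.pow _)⟩
  have hpow' : u' ^ q.den = r' ^ q.num.toNat := Subtype.ext hpow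
  refine ⟨N ^ t * u', ⟨?_, fun φ ↦ ?_⟩, by simp [u', hu]⟩
  · refine IsIntegral.of_pow q.den_pos ?_
    have : ((N : L) ^ t * u') ^ q.den =
        N ^ (t * q.den - q.num.toNat) * (N • r') ^ q.num.toNat := by
      rw [mul_pow, hpow', zsmul_eq_mul, mul_pow, ← mul_assoc, ← pow_add, ← pow_mul,
        Nat.sub_add_cancel hnum]
    rw [this]
    exact ((isIntegral_algebraMap (R := ℤ) (x := N)).pow _).mul (hN.pow _)
  · rw [map_mul, map_pow, map_intCast, norm_mul, norm_pow]
    gcongr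
    refine (pow_le_pow_iff_left₀ (norm_nonneg _) (by positivity) q.den_nz).1 ?_
    rw [← norm_pow, ← map_pow, hpow', map_pow, norm_pow, ← pow_mul]
    exact (pow_le_pow_left₀ (norm_nonneg _) (hM φ) _).trans (pow_le_pow_right₀ hM1 hnum)

open Polynomial in
theorem finite_rat_rpow_mem_range_of_transcendental {k E : Type*} [Field k] [Field E]
    [Algebra k E] [Algebra.EssFiniteType k E] (f : E →+* ℝ) {r : E} (hr0 : 0 < f r)
    (hr : Transcendental k r) (t : ℕ) :
    {q : ℚ | 0 ≤ q ∧ q ≤ t ∧ f r ^ (q : ℝ) ∈ f.range}.Finite := by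
  let F := IntermediateField.adjoin k {r}
  have : Algebra.EssFiniteType F E := .of_comp k F E
  let M := algebraicClosure F E
  have : FiniteDimensional F M := finiteDimensional_algebraicClosure_of_essFiniteType F E
  refine (Rat.finite_setOf_den_le t (2 * Module.finrank F M)).subset ?_
  rintro q ⟨hq0, hqt, u, hu⟩
  refine ⟨hq0, hqt, ?_⟩
  have hpow : u ^ q.den = r ^ q.num.toNat := f.injective <| by
    rw [map_pow, hu, map_pow, Real.rpow_ratCast_pow_den hr0.le hq0]
  let r' : F := IntermediateField.AdjoinSimple.gen k r
  have hu_alg : IsAlgebraic F u := by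
    refine IsAlgebraic.of_pow q.den_pos ?_
    rw [hpow]
    exact (isAlgebraic_algebraMap r').pow _
  have hu_pos : 0 < f u := hu ▸ Real.rpow_pos_of_pos hr0 _
  have hdvd : minpoly F u ∣ X ^ q.den - C (r' ^ q.num.toNat) :=
    minpoly.dvd _ _ (by simp [hpow, r'])
  set d := (minpoly F u).natDegree with hd
  have hd0 : 0 < d := minpoly.natDegree_pos hu_alg.isIntegral
  have hdM : d ≤ Module.finrank F M := by
    let u' : M := ⟨u, mem_algebraicClosure_iff.2 hu_alg⟩
    have : minpoly F u = minpoly F u' := minpoly.algebraMap_eq (algebraMap M E).injective u'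
    rw [hd, this]
    have : Module.Free F M := .of_divisionRing F M
    exact minpoly.natDegree_le u'
  have hc := abs_coeff_zero_eq_pow_natDegree (f.comp (algebraMap F E))
    (minpoly.monic hu_alg.isIntegral) hu_pos.le q.den_nz
    (by rw [← map_pow, hpow]; simp [r']) hdvd
  have hroot : ((minpoly F u).coeff 0 ^ 2) ^ q.den = r' ^ (2 * d * q.num.toNat) := by
    apply (f.comp (algebraMap F E)).injective
    rw [map_pow, map_pow, ← sq_abs, hc]
    have : (f u) ^ q.den = (f r) ^ q.num.toNat := by rw [← map_pow, hpow, map_pow]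
    calc ((f u ^ d) ^ 2) ^ q.den = (f u ^ q.den) ^ (2 * d) := by ring
      _ = f r ^ (2 * d * q.num.toNat) := by rw [this]; ring
      _ = _ := by simp [r']
  have h := congrArg (RatFunc.algEquivOfTranscendental r hr).symm hroot
  rw [map_pow, map_pow _ r', RatFunc.algEquivOfTranscendental_symm_gen] at h
  have hcop : q.den.Coprime q.num.toNat := by
    have := q.reduced.symm
    rwa [← Int.toNat_of_nonneg (Rat.num_nonneg.2 hq0), Int.natAbs_natCast] at this
  have := Nat.le_of_dvd (by positivity)
    (hcop.dvd_of_dvd_mul_right (RatFunc.dvd_of_pow_eq_X_pow h))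
  lia

/-- If `K ⊆ ℝ` is a finitely generated field extension of `ℚ`, `r ∈ K` is positive with
`r ≠ 1`, and `t ≥ 1`, then there are only finitely many rationals `0 < q < 1` such that
the positive real power `r ^ q` has degree at most `t` over `K`. -/
theorem finitely_many_rational_powers_of_bounded_degree (K : IntermediateField ℚ ℝ)
    (hK : K.FG) (r : ℝ) (hrK : r ∈ K) (hr0 : 0 < r) (hr1 : r ≠ 1) (t : ℕ) (ht : 0 < t) :
    {q : ℚ | 0 < q ∧ q < 1 ∧ IsAlgebraic K (r ^ (q : ℝ)) ∧
      Module.finrank K (IntermediateField.adjoin K {r ^ (q : ℝ)}) ≤ t}.Finite := by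
  have : Algebra.EssFiniteType ℚ K := IntermediateField.essFiniteType_iff.2 hK
  let r' : K := ⟨r, hrK⟩
  have hfin : {q : ℚ | 0 ≤ q ∧ q ≤ t ∧ r ^ (q : ℝ) ∈ (algebraMap K ℝ).range}.Finite := by
    by_cases hr : IsAlgebraic ℚ r'
    · exact finite_rat_rpow_mem_range_of_isAlgebraic (algebraMap K ℝ) (r := r') hr0 hr1 hr t
    · exact finite_rat_rpow_mem_range_of_transcendental (algebraMap K ℝ) (r := r') hr0 hr t
  refine ((Set.finite_Icc 1 t).biUnion fun d hd ↦ hfin.preimage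
    (f := fun q : ℚ ↦ d * q) ?_).subset ?_
  · intro x _ y _ hxy
    exact mul_left_cancel₀ (Nat.cast_ne_zero.2 (Nat.one_le_iff_ne_zero.1 hd.1)) hxy
  rintro q ⟨hq0, hq1, halg, hdeg⟩
  rw [IntermediateField.adjoin.finrank halg.isIntegral] at hdeg
  have hpos := Real.rpow_pos_of_pos hr0 (q : ℝ)
  have hpow := Real.rpow_ratCast_pow_den hr0.le hq0.le
  have hc := abs_coeff_zero_eq_pow_natDegree (algebraMap K ℝ)
    (minpoly.monic halg.isIntegral) hpos.le q.den_nz (a := r' ^ q.num.toNat)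
    (by rw [hpow]; simp [r'])
    (minpoly.dvd _ _ (by simp [hpow, r']))
  set d := (minpoly K (r ^ (q : ℝ))).natDegree
  have hd0 : 0 < d := minpoly.natDegree_pos halg.isIntegral
  refine Set.mem_biUnion (x := d) ⟨hd0, hdeg⟩ ⟨by positivity, ?_, ?_⟩
  · have : (d : ℚ) ≤ t := by exact_mod_cast hdeg
    calc (d : ℚ) * q ≤ d * 1 := by gcongr
      _ ≤ t := by simpa
  · have h : r ^ (((d : ℚ) * q : ℚ) : ℝ) = |algebraMap K ℝ ((minpoly K (r ^ (q : ℝ))).coeff 0)| := by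
      rw [hc, ← Real.rpow_mul_natCast hr0.le]
      push_cast
      rw [mul_comm]
    rw [h]
    rcases abs_choice (algebraMap K ℝ ((minpoly K (r ^ (q : ℝ))).coeff 0)) with h | h <;> rw [h]
    · exact ⟨_, rfl⟩
    · exact ⟨-_, map_neg _ _⟩
end

section
/- Let K be a field that is a finitely generated extension of ℚ, and let L be an intermediate field with ℚ ⊆ L ⊆ K. Then the relative algebraic closure of L in K (the set of elements of K that are algebraic over L) is a finite field extension of L. -/
/-- If `x` is algebraically independent over an `R`-algebra `A`, then `R`-linearly independent
elements of `A` remain linearly independent over the subalgebra generated by `x`. -/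
theorem AlgebraicIndependent.linearIndependent_algebraAdjoin {R A E ι κ : Type*}
    [CommRing R] [CommRing A] [CommRing E] [Algebra R A] [Algebra R E] [Algebra A E]
    [IsScalarTower R A E] {x : ι → E} (hx : AlgebraicIndependent A x) {b : κ → A}
    (hb : LinearIndependent R b) :
    LinearIndependent (Algebra.adjoin R (Set.range x)) (fun i ↦ algebraMap A E (b i)) := by
  rw [linearIndependent_iff']
  intro s g hg
  have hp (i : κ) : ∃ p : MvPolynomial ι R, MvPolynomial.aeval x p = (g i : E) :=
    (Algebra.adjoin_range_eq_range_aeval R x).le (g i).2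
  choose p hp using hp
  have hP : ∑ i ∈ s, b i • MvPolynomial.map (algebraMap R A) (p i) = 0 := by
    apply (injective_iff_map_eq_zero _).1 hx
    rw [map_sum, ← hg]
    refine Finset.sum_congr rfl fun i _ ↦ ?_
    rw [map_smul, MvPolynomial.aeval_map_algebraMap, hp, Algebra.smul_def, Algebra.smul_def,
      mul_comm]
    rfl
  intro i hi
  have hpi : p i = 0 := by
    ext m
    refine linearIndependent_iff'.1 hb s (fun j ↦ (p j).coeff m) ?_ i hi
    simpa [MvPolynomial.coeff_sum, MvPolynomial.coeff_map, Algebra.smul_def, mul_comm] using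
      congrArg (MvPolynomial.coeff m) hP
  ext
  rw [← hp i, hpi, map_zero, ZeroMemClass.coe_zero]

open scoped IntermediateField.algebraAdjoinAdjoin in
/-- The relative algebraic closure in a finitely generated field extension is finite. -/
theorem IntermediateField.finite_algebraicClosure_of_essFiniteType (F E : Type*)
    [Field F] [Field E] [Algebra F E] [Algebra.EssFiniteType F E] :
    Module.Finite F (algebraicClosure F E) := by
  obtain ⟨s, hs⟩ := exists_isTranscendenceBasis F E
  have : Algebra.EssFiniteType (adjoin F (Set.range ((↑) : s → E))) E := .of_comp F _ _
  have := hs.isAlgebraic_field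
  have : Module.Finite (adjoin F (Set.range ((↑) : s → E))) E :=
    Algebra.finite_of_essFiniteType_of_isAlgebraic
  let b := Module.Basis.ofVectorSpace F (algebraicClosure F E)
  have hb := hs.1.algebraicClosure.linearIndependent_algebraAdjoin b.linearIndependent
  rw [LinearIndependent.iff_fractionRing _ (adjoin F (Set.range ((↑) : s → E)))] at hb
  have := hb.finite
  exact .of_basis b

set_option synthInstance.maxHeartbeats 400000 in
/-- Let `K` be a finitely generated field extension of `ℚ` and `L` an intermediate field
`ℚ ⊆ L ⊆ K`.  Then the relative algebraic closure of `L` in `K` (the integral closure of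
`L` in `K`) is a finite field extension of `L`. -/
theorem relative_algebraic_closure_finite (K : Type*) [Field K] [Algebra ℚ K]
    (hK : ∃ s : Finset K, IntermediateField.adjoin ℚ (s : Set K) = ⊤)
    (L : IntermediateField ℚ K) :
    Module.Finite L (integralClosure L K) := by
  have : Algebra.EssFiniteType ℚ K := IntermediateField.fg_top_iff.1 hK
  have : Algebra.EssFiniteType L K := .of_comp ℚ _ _
  exact IntermediateField.finite_algebraicClosure_of_essFiniteType L K
end
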